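/- arXiv:1908.06333 — 2 statements merged into one kernel-verified Lean document; each statement's English description precedes it below -/
import Mathlib

section
/- Let r = r(n) ≥ 3 and m = m(n) with r^{-2} n ≤ m = o(r^{-3} n^{3/2}) as n → ∞, let ξ = O(1) be a nonnegative integer, let H ∈ H_r^+(n, m−ξ), and let t be an integer with r ≤ t ≤ 3r−4. Let N_t be the number of t-element subsets of [n] that contain no two vertices lying in a common edge of H. Then, uniformly over all such H, t and ξ, N_t = [ C(n,t) − C(r,2) m C(n−2, t−2) ] · ( 1 + O( ( r^6 m n log(r^{-2}n) + r^8 m^2 ) / n^4 ) ). -/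
open Filter Finset

/-- `Hgraphs n r m`: the set of `r`-graphs on vertex set `Fin n` with exactly `m` edges. -/
def Hgraphs (n r m : ℕ) : Finset (Finset (Finset (Fin n))) :=
  Finset.univ.filter fun H => (∀ e ∈ H, e.card = r) ∧ H.card = m

/-- A hypergraph is linear if any two distinct edges share at most one vertex. -/
def IsLinear {n : ℕ} (H : Finset (Finset (Fin n))) : Prop :=
  ∀ e ∈ H, ∀ f ∈ H, e ≠ f → (e ∩ f).card ≤ 1

instance {n : ℕ} : DecidablePred (IsLinear (n := n)) := fun _ => by
  unfold IsLinear; infer_instance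

/-- `Lgraphs n r m`: the set of linear `r`-graphs on `Fin n` with exactly `m` edges. -/
def Lgraphs (n r m : ℕ) : Finset (Finset (Finset (Fin n))) :=
  (Hgraphs n r m).filter IsLinear

/-- The degree of a vertex: the number of edges containing it. -/
def hdegree {n : ℕ} (H : Finset (Finset (Fin n))) (v : Fin n) : ℕ :=
  (H.filter fun e => v ∈ e).card

/-- `C` is a cluster of `H`: the edge set of a component, with at least two edges, of the
graph on the edges of `H` in which two edges are adjacent iff they are linked (they meet in
exactly two vertices). -/
def IsCluster {n : ℕ} (H C : Finset (Finset (Fin n))) : Prop :=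
  C ⊆ H ∧ 2 ≤ C.card ∧
  (∀ e ∈ C, ∀ f ∈ C,
    Relation.ReflTransGen (fun a b => a ∈ C ∧ b ∈ C ∧ (a ∩ b).card = 2) e f) ∧
  (∀ e ∈ C, ∀ f ∈ H, (e ∩ f).card = 2 → f ∈ C)

/-- Type-1 cluster: three edges spanning `3r-4` vertices, one edge `e` linked to each of
`f, g` through two disjoint `2`-subsets of `e`, with `f` and `g` meeting only inside `e`. -/
def IsType1 {n : ℕ} (r : ℕ) (C : Finset (Finset (Fin n))) : Prop :=
  ∃ e f g : Finset (Fin n), C = {e, f, g} ∧ e ≠ f ∧ e ≠ g ∧ f ≠ g ∧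
    (C.sup id).card = 3 * r - 4 ∧
    (e ∩ f).card = 2 ∧ (e ∩ g).card = 2 ∧ Disjoint (e ∩ f) (e ∩ g) ∧ f ∩ g ⊆ e

/-- Type-2 cluster: as Type-1 but the two `2`-subsets of `e` share exactly one vertex. -/
def IsType2 {n : ℕ} (r : ℕ) (C : Finset (Finset (Fin n))) : Prop :=
  ∃ e f g : Finset (Fin n), C = {e, f, g} ∧ e ≠ f ∧ e ≠ g ∧ f ≠ g ∧
    (C.sup id).card = 3 * r - 4 ∧
    (e ∩ f).card = 2 ∧ (e ∩ g).card = 2 ∧ ((e ∩ f) ∩ (e ∩ g)).card = 1 ∧ f ∩ g ⊆ e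

/-- Type-3 cluster: three edges containing a common `2`-subset and pairwise disjoint
outside it. -/
def IsType3 {n : ℕ} (r : ℕ) (C : Finset (Finset (Fin n))) : Prop :=
  ∃ e f g : Finset (Fin n), C = {e, f, g} ∧ e ≠ f ∧ e ≠ g ∧ f ≠ g ∧
    (C.sup id).card = 3 * r - 4 ∧
    ∃ s : Finset (Fin n), s.card = 2 ∧ e ∩ f = s ∧ e ∩ g = s ∧ f ∩ g = s

/-- Type-4 cluster: exactly two linked edges. -/
def IsType4 {n : ℕ} (C : Finset (Finset (Fin n))) : Prop :=
  ∃ e f : Finset (Fin n), C = {e, f} ∧ e ≠ f ∧ (e ∩ f).card = 2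

/-- The number of clusters of `H` satisfying a property `P`. -/
noncomputable def clusterCount {n : ℕ} (H : Finset (Finset (Fin n)))
    (P : Finset (Finset (Fin n)) → Prop) : ℕ :=
  {C | IsCluster H C ∧ P C}.ncard

noncomputable def M0star (n r m : ℕ) : ℕ :=
  ⌈Real.log ((n : ℝ) / (r : ℝ) ^ 2) + 81 * (r : ℝ) ^ 2 * (m : ℝ) / (n : ℝ)⌉₊

noncomputable def M0 (n r m : ℕ) : ℕ := M0star n r m + 3

noncomputable def M1 (n r m : ℕ) : ℕ :=
  ⌈Real.log ((n : ℝ) / (r : ℝ) ^ 2) + 81 * (r : ℝ) ^ 8 * (m : ℝ) ^ 3 / (2 * (n : ℝ) ^ 4)⌉₊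

noncomputable def M2 (n r m : ℕ) : ℕ :=
  ⌈Real.log ((n : ℝ) / (r : ℝ) ^ 2) + 81 * (r : ℝ) ^ 7 * (m : ℝ) ^ 3 / (2 * (n : ℝ) ^ 4)⌉₊

noncomputable def M3 (n r m : ℕ) : ℕ :=
  ⌈Real.log ((n : ℝ) / (r : ℝ) ^ 2) + 81 * (r : ℝ) ^ 6 * (m : ℝ) ^ 3 / (2 * (n : ℝ) ^ 4)⌉₊

noncomputable def M4 (n r m : ℕ) : ℕ :=
  ⌈Real.log ((n : ℝ) / (r : ℝ) ^ 2) + 81 * (r : ℝ) ^ 4 * (m : ℝ) ^ 2 / (2 * (n : ℝ) ^ 2)⌉₊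

/-- `H_r^+(n,m)` with a prescribed degree bound `d₀` in place of property (g). -/
def HplusAux (n r m d₀ : ℕ) : Set (Finset (Finset (Fin n))) :=
  {H | H ∈ Hgraphs n r m ∧
    (∀ e ∈ H, ∀ f ∈ H, e ≠ f → (e ∩ f).card ≤ 2) ∧
    (∀ C, IsCluster H C → IsType1 r C ∨ IsType2 r C ∨ IsType3 r C ∨ IsType4 C) ∧
    (∀ C D, IsCluster H C → IsCluster H D → C ≠ D →
      ((C.sup id) ∩ (D.sup id)).card ≤ 1) ∧
    (∀ C D E, IsCluster H C → IsCluster H D → IsCluster H E →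
      C ≠ D → C ≠ E → D ≠ E →
      (IsType1 r C ∨ IsType2 r C ∨ IsType3 r C) →
      (IsType1 r D ∨ IsType2 r D ∨ IsType3 r D) →
      (IsType1 r E ∨ IsType2 r E ∨ IsType3 r E) →
      9 * r - 13 ≤ ((C.sup id) ∪ (D.sup id) ∪ (E.sup id)).card) ∧
    (∀ C D E, IsCluster H C → IsCluster H D → IsCluster H E →
      C ≠ D → C ≠ E → D ≠ E → IsType4 C → IsType4 D → IsType4 E →
      6 * r - 8 ≤ ((C.sup id) ∪ (D.sup id) ∪ (E.sup id)).card) ∧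
    clusterCount H (IsType1 r) ≤ M1 n r m ∧
    clusterCount H (IsType2 r) ≤ M2 n r m ∧
    clusterCount H (IsType3 r) ≤ M3 n r m ∧
    clusterCount H IsType4 ≤ M4 n r m ∧
    (∀ v, hdegree H v ≤ d₀)}

/-- `H_r^+(n,m)`: `r`-graphs with `m` edges satisfying properties (a)–(g). -/
noncomputable def Hplus (n r m : ℕ) : Set (Finset (Finset (Fin n))) :=
  HplusAux n r m (M0 n r m)

/-- `H_r^{++}(n,m)`: as `H_r^+(n,m)` but with the stronger degree bound `M₀*`. -/
noncomputable def Hplusplus (n r m : ℕ) : Set (Finset (Finset (Fin n))) :=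
  HplusAux n r m (M0star n r m)

/-- `C^+_{h₁,h₂,h₃,h₄}`: members of `H_r^+(n,m)` with exactly `hᵢ` Type-`i` clusters. -/
noncomputable def Cplus (n r m h₁ h₂ h₃ h₄ : ℕ) : Set (Finset (Finset (Fin n))) :=
  {H ∈ Hplus n r m | clusterCount H (IsType1 r) = h₁ ∧ clusterCount H (IsType2 r) = h₂ ∧
    clusterCount H (IsType3 r) = h₃ ∧ clusterCount H IsType4 = h₄}

/-- `C^{++}_{h₁,h₂,h₃,h₄}`: members of `H_r^{++}(n,m)` with exactly `hᵢ` Type-`i` clusters. -/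
noncomputable def Cplusplus (n r m h₁ h₂ h₃ h₄ : ℕ) : Set (Finset (Finset (Fin n))) :=
  {H ∈ Hplusplus n r m | clusterCount H (IsType1 r) = h₁ ∧ clusterCount H (IsType2 r) = h₂ ∧
    clusterCount H (IsType3 r) = h₃ ∧ clusterCount H IsType4 = h₄}


theorem choose_sub_mul_pow_le {n t k : ℕ} (hkt : k ≤ t) (htn : t ≤ n) :
    (n - k).choose (t - k) * n ^ k ≤ n.choose t * t ^ k := by
  induction k generalizing n t with
  | zero => simp
  | succ k ih =>
    obtain ⟨t, rfl⟩ : ∃ u, t = u + 1 := ⟨t - 1, by omega⟩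
    obtain ⟨n, rfl⟩ : ∃ u, n = u + 1 := ⟨n - 1, by omega⟩
    have h := ih (n := n) (t := t) (by omega) (by omega)
    rw [Nat.add_sub_add_right, Nat.add_sub_add_right]
    rcases Nat.eq_zero_or_pos n with rfl | hn
    · obtain rfl : t = 0 := by omega
      obtain rfl : k = 0 := by omega
      simp
    have hpow : (n + 1) ^ k * t ^ k ≤ n ^ k * (t + 1) ^ k := by
      rw [← mul_pow, ← mul_pow]
      exact Nat.pow_le_pow_left (by nlinarith) _
    have hc := Nat.add_one_mul_choose_eq n t
    refine Nat.le_of_mul_le_mul_right (c := n ^ k) ?_ (by positivity)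
    calc (n - k).choose (t - k) * (n + 1) ^ (k + 1) * n ^ k
        = ((n - k).choose (t - k) * n ^ k) * (n + 1) * (n + 1) ^ k := by ring
      _ ≤ (n.choose t * t ^ k) * (n + 1) * (n + 1) ^ k := by gcongr
      _ = ((n + 1) * n.choose t) * ((n + 1) ^ k * t ^ k) := by ring
      _ ≤ ((n + 1) * n.choose t) * (n ^ k * (t + 1) ^ k) := by gcongr
      _ = (n + 1).choose (t + 1) * (t + 1) ^ (k + 1) * n ^ k := by rw [hc]; ring

section Combinatorics

variable {α : Type*} [DecidableEq α]

theorem card_powersetCard_filter_superset_mul_pow_le [Fintype α] (U : Finset α) {t : ℕ}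
    (ht : t ≤ Fintype.card α) :
    ((univ.powersetCard t).filter (U ⊆ ·)).card * Fintype.card α ^ U.card
      ≤ (Fintype.card α).choose t * t ^ U.card := by
  rcases le_or_gt U.card t with h | h
  · rw [card_filter_powersetCard_subset U univ t (subset_univ U) h, card_univ]
    exact choose_sub_mul_pow_le h ht
  · rw [filter_false_of_mem]
    · simp
    · intro S hS hU
      have := card_le_card hU
      rw [mem_powersetCard_univ] at hS
      omega

/-- The members of `𝒜` that contain no member of `P` number at least the first-order
inclusion-exclusion sum. -/
theorem card_sub_sum_le_card_avoiding (𝒜 P : Finset (Finset α))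
    [DecidablePred fun S => ∀ p ∈ P, ¬ p ⊆ S] :
    (𝒜.card : ℝ) - ∑ p ∈ P, ((𝒜.filter (p ⊆ ·)).card : ℝ)
      ≤ ((𝒜.filter fun S => ∀ p ∈ P, ¬ p ⊆ S).card : ℝ) := by
  have h : ∑ p ∈ P, ((𝒜.filter (p ⊆ ·)).card : ℝ)
      = ∑ S ∈ 𝒜, ((P.filter (· ⊆ S)).card : ℝ) := by
    exact_mod_cast sum_card_bipartiteAbove_eq_sum_card_bipartiteBelow (s := P) (t := 𝒜)
      (fun p S => p ⊆ S)
  rw [h, card_filter, Nat.cast_sum, card_eq_sum_ones, Nat.cast_sum, ← sum_sub_distrib]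
  refine sum_le_sum fun S _ => ?_
  split_ifs with hS
  · simp
  · push Not at hS
    obtain ⟨p, hp, hpS⟩ := hS
    have : 0 < (P.filter (· ⊆ S)).card := card_pos.2 ⟨p, mem_filter.2 ⟨hp, hpS⟩⟩
    have : (1 : ℝ) ≤ ((P.filter (· ⊆ S)).card : ℝ) := by exact_mod_cast this
    simpa using this

theorem card_avoiding_le (𝒜 P : Finset (Finset α))
    [DecidablePred fun S => ∀ p ∈ P, ¬ p ⊆ S] :
    ((𝒜.filter fun S => ∀ p ∈ P, ¬ p ⊆ S).card : ℝ)
      ≤ (𝒜.card : ℝ) - ∑ p ∈ P, ((𝒜.filter (p ⊆ ·)).card : ℝ)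
        + ∑ x ∈ P.offDiag, ((𝒜.filter (x.1 ∪ x.2 ⊆ ·)).card : ℝ) := by
  have h : ∑ p ∈ P, ((𝒜.filter (p ⊆ ·)).card : ℝ)
      = ∑ S ∈ 𝒜, ((P.filter (· ⊆ S)).card : ℝ) := by
    exact_mod_cast sum_card_bipartiteAbove_eq_sum_card_bipartiteBelow (s := P) (t := 𝒜)
      (fun p S => p ⊆ S)
  have h' : ∑ x ∈ P.offDiag, ((𝒜.filter (x.1 ∪ x.2 ⊆ ·)).card : ℝ)
      = ∑ S ∈ 𝒜, ((P.offDiag.filter fun x => x.1 ∪ x.2 ⊆ S).card : ℝ) := by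
    exact_mod_cast sum_card_bipartiteAbove_eq_sum_card_bipartiteBelow (s := P.offDiag) (t := 𝒜)
      (fun x S => x.1 ∪ x.2 ⊆ S)
  have h'' : ∀ S : Finset α, (P.offDiag.filter fun x => x.1 ∪ x.2 ⊆ S)
      = (P.filter (· ⊆ S)).offDiag := by
    intro S
    ext x
    simp only [mem_filter, mem_offDiag, union_subset_iff]
    tauto
  rw [h, h', card_filter, Nat.cast_sum, card_eq_sum_ones 𝒜, Nat.cast_sum, ← sum_sub_distrib,
    ← sum_add_distrib]
  refine sum_le_sum fun S _ => ?_
  rw [h'', offDiag_card, Nat.cast_sub (Nat.le_mul_self _)]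
  split_ifs with hS
  · rw [filter_false_of_mem hS]
    simp
  · have : 0 ≤ (((P.filter (· ⊆ S)).card : ℝ) - 1) ^ 2 := sq_nonneg _
    push_cast
    nlinarith

/-- The pairs of vertices covered by the edges of `H`. -/
def coveredPairs (H : Finset (Finset α)) : Finset (Finset α) :=
  H.biUnion (powersetCard 2)

theorem mem_coveredPairs {H : Finset (Finset α)} {p : Finset α} :
    p ∈ coveredPairs H ↔ ∃ e ∈ H, p ⊆ e ∧ p.card = 2 := by
  simp [coveredPairs, mem_powersetCard]

theorem forall_card_inter_le_one_iff (H : Finset (Finset α)) (S : Finset α) :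
    (∀ e ∈ H, (S ∩ e).card ≤ 1) ↔ ∀ p ∈ coveredPairs H, ¬ p ⊆ S := by
  simp only [mem_coveredPairs]
  constructor
  · rintro h p ⟨e, he, hpe, hp⟩ hpS
    have := card_le_card (subset_inter hpS hpe)
    have := h e he
    omega
  · intro h e he
    by_contra! hlt
    obtain ⟨p, hp, hc⟩ := exists_subset_card_eq (show 2 ≤ (S ∩ e).card from hlt)
    exact h p ⟨e, he, hp.trans inter_subset_right, hc⟩ (hp.trans inter_subset_left)

theorem card_coveredPairs_le {H : Finset (Finset α)} {r : ℕ} (hH : ∀ e ∈ H, e.card = r) :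
    (coveredPairs H).card ≤ r.choose 2 * H.card := by
  rw [mul_comm]
  refine card_biUnion_le_card_mul _ _ _ fun e he => ?_
  rw [card_powersetCard, hH e he]

theorem choose_two_mul_card_le {H : Finset (Finset α)} {r : ℕ} (hH : ∀ e ∈ H, e.card = r)
    (h2 : ∀ e ∈ H, ∀ f ∈ H, e ≠ f → (e ∩ f).card ≤ 2) :
    r.choose 2 * H.card ≤ (coveredPairs H).card
      + (H.offDiag.filter fun x => (x.1 ∩ x.2).card = 2).card := by
  have h1 : r.choose 2 * H.card = ∑ p ∈ coveredPairs H, (H.filter (p ⊆ ·)).card := by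
    have := sum_card_bipartiteAbove_eq_sum_card_bipartiteBelow (s := coveredPairs H) (t := H)
      (fun p e => p ⊆ e)
    refine Eq.trans ?_ this.symm
    rw [mul_comm]
    refine (sum_const_nat fun e he => ?_).symm
    rw [← hH e he, ← card_powersetCard]
    congr 1
    ext p
    simp only [bipartiteBelow, mem_filter, mem_coveredPairs, mem_powersetCard]
    exact ⟨fun ⟨⟨_, _, _, hc⟩, hp⟩ => ⟨hp, hc⟩, fun ⟨hp, hc⟩ => ⟨⟨e, he, hp, hc⟩, hp⟩⟩
  have h3 : ∑ p ∈ coveredPairs H, (H.offDiag.filter fun x => x.1 ∩ x.2 = p).card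
      ≤ (H.offDiag.filter fun x => (x.1 ∩ x.2).card = 2).card := by
    rw [← card_biUnion]
    · refine card_le_card fun x hx => ?_
      simp only [mem_biUnion, mem_filter, mem_coveredPairs] at hx ⊢
      obtain ⟨p, ⟨_, _, _, hp⟩, hx, rfl⟩ := hx
      exact ⟨hx, hp⟩
    · intro p _ q _ hpq
      refine disjoint_left.2 fun x hx hx' => hpq ?_
      rw [← (mem_filter.1 hx).2, ← (mem_filter.1 hx').2]
  rw [h1]
  refine le_trans ?_ (Nat.add_le_add_left h3 _)
  rw [card_eq_sum_ones, ← sum_add_distrib]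
  refine sum_le_sum fun p hp => ?_
  have hsub : (H.filter (p ⊆ ·)).offDiag ⊆ H.offDiag.filter fun x => x.1 ∩ x.2 = p := by
    intro x hx
    simp only [mem_filter, mem_offDiag] at hx ⊢
    obtain ⟨⟨he, hpe⟩, ⟨hf, hpf⟩, hne⟩ := hx
    refine ⟨⟨he, hf, hne⟩, (eq_of_subset_of_card_le (subset_inter hpe hpf) ?_).symm⟩
    obtain ⟨_, _, _, hc⟩ := mem_coveredPairs.1 hp
    rw [hc]
    exact h2 _ he _ hf hne
  refine le_trans ?_ (Nat.add_le_add_left (card_le_card hsub) _)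
  rw [offDiag_card]
  generalize (H.filter (p ⊆ ·)).card = k
  rcases k with _ | _ | k
  · simp
  · simp
  · have : (k + 1 + 1) * (k + 1 + 1) = (k + 1 + 1) + (k + 1 + 1) * (k + 1) := by ring
    rw [this, Nat.add_sub_cancel_left]
    nlinarith

theorem card_coveredPairs_filter_mem_le {H : Finset (Finset α)} {r d : ℕ}
    (hH : ∀ e ∈ H, e.card = r) (v : α) (hd : (H.filter fun e => v ∈ e).card ≤ d) :
    ((coveredPairs H).filter (v ∈ ·)).card ≤ d * r := by
  have hsub : (coveredPairs H).filter (v ∈ ·)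
      ⊆ (H.filter fun e => v ∈ e).biUnion fun e => e.image fun w => {v, w} := by
    intro p hp
    rw [mem_filter, mem_coveredPairs] at hp
    obtain ⟨⟨e, he, hpe, hc⟩, hv⟩ := hp
    obtain ⟨x, y, -, rfl⟩ := card_eq_two.1 hc
    simp only [mem_biUnion, mem_filter, mem_image]
    refine ⟨e, ⟨he, hpe hv⟩, ?_⟩
    simp only [mem_insert, mem_singleton] at hv
    rcases hv with rfl | rfl
    · exact ⟨y, hpe (by simp), rfl⟩
    · exact ⟨x, hpe (by simp), pair_comm _ _⟩
  refine (card_le_card hsub).trans ((card_biUnion_le_card_mul _ _ r fun e he => ?_).trans ?_)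
  · rw [← hH e (mem_filter.1 he).1]
    exact card_image_le
  · exact Nat.mul_le_mul_right _ hd

theorem card_offDiag_coveredPairs_not_disjoint_le {H : Finset (Finset α)} {r d : ℕ}
    (hH : ∀ e ∈ H, e.card = r) (hd : ∀ v, (H.filter fun e => v ∈ e).card ≤ d) :
    ((coveredPairs H).offDiag.filter fun x => ¬ Disjoint x.1 x.2).card
      ≤ (coveredPairs H).card * (2 * (d * r)) := by
  have hsub : ((coveredPairs H).offDiag.filter fun x => ¬ Disjoint x.1 x.2)
      ⊆ (coveredPairs H).biUnion fun p => p.biUnion fun v =>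
        ((coveredPairs H).filter (v ∈ ·)).image fun q => (p, q) := by
    rintro ⟨p, q⟩ hx
    simp only [mem_filter, mem_offDiag, not_disjoint_iff] at hx
    obtain ⟨⟨hp, hq, -⟩, v, hvp, hvq⟩ := hx
    simp only [mem_biUnion, mem_image, mem_filter]
    exact ⟨p, hp, v, hvp, q, ⟨hq, hvq⟩, rfl⟩
  refine (card_le_card hsub).trans (card_biUnion_le_card_mul _ _ _ fun p hp => ?_)
  obtain ⟨_, _, _, hc⟩ := mem_coveredPairs.1 hp
  rw [← hc]
  exact card_biUnion_le_card_mul _ _ _ fun v _ =>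
    card_image_le.trans (card_coveredPairs_filter_mem_le hH v (hd v))

theorem sum_offDiag_coveredPairs_le [Fintype α] {H : Finset (Finset α)} {r d t : ℕ}
    (hH : ∀ e ∈ H, e.card = r) (hd : ∀ v, (H.filter fun e => v ∈ e).card ≤ d)
    (hn : 0 < Fintype.card α) (ht : t ≤ Fintype.card α) :
    ∑ x ∈ (coveredPairs H).offDiag,
        (((univ.powersetCard t).filter (x.1 ∪ x.2 ⊆ ·)).card : ℝ)
      ≤ ((Fintype.card α).choose t : ℝ)
        * ((coveredPairs H).card ^ 2 * ((t : ℝ) / Fintype.card α) ^ 4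
          + (coveredPairs H).card * (2 * (d * r)) * ((t : ℝ) / Fintype.card α) ^ 3) := by
  set P := coveredPairs H with hP
  have hcnt : ∀ U : Finset α, (((univ.powersetCard t).filter (U ⊆ ·)).card : ℝ)
      ≤ (Fintype.card α).choose t * ((t : ℝ) / Fintype.card α) ^ U.card := by
    intro U
    rw [div_pow, ← mul_div_assoc, le_div_iff₀ (by positivity)]
    exact_mod_cast card_powersetCard_filter_superset_mul_pow_le U ht
  have hP2 : ∀ p ∈ P, p.card = 2 := fun p hp => by
    obtain ⟨_, _, _, hc⟩ := mem_coveredPairs.1 hp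
    exact hc
  rw [← sum_filter_add_sum_filter_not _ (fun x => Disjoint x.1 x.2), mul_add]
  refine add_le_add ?_ ?_
  · refine (sum_le_card_nsmul _ _
      ((Fintype.card α).choose t * ((t : ℝ) / Fintype.card α) ^ 4) ?_).trans ?_
    · intro x hx
      rw [mem_filter, mem_offDiag] at hx
      have := hcnt (x.1 ∪ x.2)
      rwa [card_union_of_disjoint hx.2, hP2 _ hx.1.1, hP2 _ hx.1.2.1] at this
    · have h : ((P.offDiag.filter fun x => Disjoint x.1 x.2).card : ℝ) ≤ (P.card : ℝ) ^ 2 := by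
        have := (card_filter_le P.offDiag fun x => Disjoint x.1 x.2).trans
          ((offDiag_card P).le.trans (Nat.sub_le _ _))
        rw [sq]
        exact_mod_cast this
      rw [nsmul_eq_mul]
      calc _ ≤ (P.card : ℝ) ^ 2
            * ((Fintype.card α).choose t * ((t : ℝ) / Fintype.card α) ^ 4) := by gcongr
        _ = _ := by ring
  · refine (sum_le_card_nsmul _ _
      ((Fintype.card α).choose t * ((t : ℝ) / Fintype.card α) ^ 3) ?_).trans ?_
    · intro x hx
      rw [mem_filter, mem_offDiag] at hx
      obtain ⟨⟨h1, h2, hne⟩, hnd⟩ := hx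
      have h3 := card_union_add_card_inter x.1 x.2
      have h4 : (x.1 ∩ x.2).card ≠ 0 := by
        rwa [Ne, card_eq_zero, ← disjoint_iff_inter_eq_empty]
      have h5 : (x.1 ∩ x.2).card < 2 := by
        by_contra! h
        have e1 := eq_of_subset_of_card_le (inter_subset_left (s₁ := x.1) (s₂ := x.2))
          (by rwa [hP2 _ h1])
        have e2 := eq_of_subset_of_card_le (inter_subset_right (s₁ := x.1) (s₂ := x.2))
          (by rwa [hP2 _ h2])
        exact hne (e1.symm.trans e2)
      rw [hP2 _ h1, hP2 _ h2] at h3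
      have := hcnt (x.1 ∪ x.2)
      rwa [show (x.1 ∪ x.2).card = 3 by omega] at this
    · have h : ((P.offDiag.filter fun x => ¬ Disjoint x.1 x.2).card : ℝ)
          ≤ (P.card : ℝ) * (2 * (d * r)) := by
        exact_mod_cast card_offDiag_coveredPairs_not_disjoint_le hH hd
      rw [nsmul_eq_mul]
      calc _ ≤ (P.card : ℝ) * (2 * (d * r))
            * ((Fintype.card α).choose t * ((t : ℝ) / Fintype.card α) ^ 3) := by gcongr
        _ = _ := by ring

end Combinatorics

section Clusters

variable {n : ℕ}

theorem exists_isCluster_of_linked {H : Finset (Finset (Fin n))} {e f : Finset (Fin n)}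
    (he : e ∈ H) (hf : f ∈ H) (hne : e ≠ f) (hef : (e ∩ f).card = 2) :
    ∃ C, IsCluster H C ∧ e ∈ C ∧ f ∈ C := by
  classical
  let R : Finset (Fin n) → Finset (Fin n) → Prop := fun a b => a ∈ H ∧ b ∈ H ∧ (a ∩ b).card = 2
  let C := H.filter fun g => Relation.ReflTransGen R e g
  have heC : e ∈ C := mem_filter.2 ⟨he, .refl⟩
  have hfC : f ∈ C := mem_filter.2 ⟨hf, .single ⟨he, hf, hef⟩⟩
  have hclosed : ∀ a ∈ C, ∀ b ∈ H, (a ∩ b).card = 2 → b ∈ C := fun a ha b hb hab =>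
    mem_filter.2 ⟨hb, (mem_filter.1 ha).2.tail ⟨(mem_filter.1 ha).1, hb, hab⟩⟩
  let R' : Finset (Fin n) → Finset (Fin n) → Prop := fun a b => a ∈ C ∧ b ∈ C ∧ (a ∩ b).card = 2
  have hpath : ∀ g, Relation.ReflTransGen R e g → Relation.ReflTransGen R' e g := by
    intro g hg
    induction hg with
    | refl => exact .refl
    | tail hab hbc ih =>
      have hb := mem_filter.2 ⟨hbc.1, hab⟩
      exact ih.tail ⟨hb, hclosed _ hb _ hbc.2.1 hbc.2.2, hbc.2.2⟩
  have : Std.Symm R' := ⟨fun a b ⟨ha, hb, h⟩ => ⟨hb, ha, by rwa [inter_comm]⟩⟩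
  refine ⟨C, ⟨filter_subset _ _, ?_, fun a ha b hb => ?_, hclosed⟩, heC, hfC⟩
  · exact one_lt_card.2 ⟨e, heC, f, hfC, hne⟩
  · exact (Relation.ReflTransGen.stdSymm.symm _ _ (hpath a (mem_filter.1 ha).2)).trans
      (hpath b (mem_filter.1 hb).2)

theorem card_linked_le {H : Finset (Finset (Fin n))} {r : ℕ}
    (hb : ∀ C, IsCluster H C → IsType1 r C ∨ IsType2 r C ∨ IsType3 r C ∨ IsType4 C) :
    (H.offDiag.filter fun x => (x.1 ∩ x.2).card = 2).card
      ≤ 9 * (clusterCount H (IsType1 r) + clusterCount H (IsType2 r)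
        + clusterCount H (IsType3 r) + clusterCount H IsType4) := by
  classical
  let K := H.powerset.filter fun C => IsCluster H C
  have hK : ∀ C, C ∈ K ↔ IsCluster H C := fun C => by
    simp only [K, mem_filter, mem_powerset, and_iff_right_iff_imp]
    exact fun h => h.1
  have hcard : ∀ C ∈ K, C.card ≤ 3 := by
    intro C hC
    rcases hb C ((hK C).1 hC) with ⟨e, f, g, rfl, -⟩ | ⟨e, f, g, rfl, -⟩ | ⟨e, f, g, rfl, -⟩ |
      ⟨e, f, rfl, -⟩
    · exact card_le_three
    · exact card_le_three
    · exact card_le_three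
    · exact card_le_two.trans (by norm_num)
  have hcount : ∀ P : Finset (Finset (Fin n)) → Prop,
      (K.filter P).card = clusterCount H P := by
    intro P
    rw [clusterCount, ← Set.ncard_coe_finset]
    congr 1
    ext C
    simp [hK]
  have hsub : (H.offDiag.filter fun x => (x.1 ∩ x.2).card = 2) ⊆ K.biUnion fun C => C ×ˢ C := by
    rintro ⟨e, f⟩ hx
    simp only [mem_filter, mem_offDiag] at hx
    obtain ⟨⟨he, hf, hne⟩, hc⟩ := hx
    obtain ⟨C, hC, heC, hfC⟩ := exists_isCluster_of_linked he hf hne hc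
    exact mem_biUnion.2 ⟨C, (hK C).2 hC, mem_product.2 ⟨heC, hfC⟩⟩
  have hcover : K ⊆ K.filter (IsType1 r) ∪ K.filter (IsType2 r) ∪ K.filter (IsType3 r)
      ∪ K.filter IsType4 := by
    intro C hC
    simp only [mem_union, mem_filter, hC, true_and]
    have := hb C ((hK C).1 hC)
    tauto
  have hKcard : K.card ≤ clusterCount H (IsType1 r) + clusterCount H (IsType2 r)
      + clusterCount H (IsType3 r) + clusterCount H IsType4 := by
    simp only [← hcount]
    refine (card_le_card hcover).trans ((card_union_le _ _).trans ?_)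
    gcongr
    refine (card_union_le _ _).trans ?_
    gcongr
    exact card_union_le _ _
  refine (card_le_card hsub).trans ((card_biUnion_le_card_mul _ _ 9 fun C hC => ?_).trans ?_)
  · rw [card_product]
    exact Nat.mul_le_mul (hcard C hC) (hcard C hC)
  · rw [mul_comm]
    gcongr

end Clusters

theorem natCeil_le_of_le {x y : ℝ} (hxy : x ≤ y) (hy : 0 ≤ y) : (⌈x⌉₊ : ℝ) ≤ y + 1 :=
  (Nat.cast_le.2 (Nat.ceil_mono hxy)).trans (Nat.ceil_lt_add_one hy).le

/-- Two-sided estimate for the number of `t`-sets meeting every edge of `H` in at most one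
vertex. -/
theorem abs_card_independent_sub_le {n r m k t d L : ℕ} {H : Finset (Finset (Fin n))}
    (hH : ∀ e ∈ H, e.card = r) (hHk : H.card = k) (hkm : k ≤ m)
    (h2 : ∀ e ∈ H, ∀ f ∈ H, e ≠ f → (e ∩ f).card ≤ 2)
    (hL : (H.offDiag.filter fun x => (x.1 ∩ x.2).card = 2).card ≤ L)
    (hd : ∀ v, hdegree H v ≤ d) (ht2 : 2 ≤ t) (hn : 0 < n) (ht : t ≤ n) :
    |((univ.powerset.filter fun S : Finset (Fin n) =>
          S.card = t ∧ ∀ e ∈ H, (S ∩ e).card ≤ 1).card : ℝ)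
        - ((n.choose t : ℝ) - (r.choose 2 : ℝ) * m * ((n - 2).choose (t - 2) : ℝ))|
      ≤ n.choose t * (((r.choose 2 : ℝ) * ((m : ℝ) - k) + L) * ((t : ℝ) / n) ^ 2
          + (r.choose 2 * m : ℝ) ^ 2 * ((t : ℝ) / n) ^ 4
          + (r.choose 2 * m : ℝ) * (2 * (d * r)) * ((t : ℝ) / n) ^ 3) := by
  set P := coveredPairs H with hP
  have hset : (univ.powerset.filter fun S : Finset (Fin n) =>
      S.card = t ∧ ∀ e ∈ H, (S ∩ e).card ≤ 1)
      = (univ.powersetCard t).filter fun S => ∀ p ∈ P, ¬ p ⊆ S := by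
    ext S
    simp only [mem_filter, powerset_univ, mem_univ, true_and, mem_powersetCard_univ,
      forall_card_inter_le_one_iff, hP]
  have hA : ((univ.powersetCard t : Finset (Finset (Fin n))).card : ℝ) = n.choose t := by simp
  set T : ℝ := ((n - 2).choose (t - 2) : ℝ) with hT
  have hsum : ∑ p ∈ P, (((univ.powersetCard t).filter (p ⊆ ·)).card : ℝ) = P.card * T := by
    rw [← nsmul_eq_mul, ← sum_const]
    refine sum_congr rfl fun p hp => ?_
    obtain ⟨_, _, _, hc⟩ := mem_coveredPairs.1 hp
    rw [card_filter_powersetCard_subset p univ t (subset_univ p) (by omega), hc, card_fin]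
  have hTle : T ≤ n.choose t * ((t : ℝ) / n) ^ 2 := by
    rw [hT, div_pow, ← mul_div_assoc, le_div_iff₀ (by positivity)]
    exact_mod_cast choose_sub_mul_pow_le ht2 ht
  have hlow := card_sub_sum_le_card_avoiding (univ.powersetCard t) P
  have hupp := card_avoiding_le (univ.powersetCard t) P
  have hpairs := sum_offDiag_coveredPairs_le (t := t) hH hd (by simpa using hn) (by simpa using ht)
  rw [← hP, Fintype.card_fin] at hpairs
  rw [hset]
  rw [hA, hsum] at hlow hupp
  have hPk : (P.card : ℝ) ≤ r.choose 2 * k := by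
    exact_mod_cast hHk ▸ card_coveredPairs_le hH
  have hPL : (r.choose 2 : ℝ) * k ≤ P.card + L := by
    exact_mod_cast hHk ▸ (choose_two_mul_card_le hH h2).trans (Nat.add_le_add_left hL _)
  have hkm' : (k : ℝ) ≤ m := by exact_mod_cast hkm
  have hPm : (P.card : ℝ) ≤ r.choose 2 * m := hPk.trans (by gcongr)
  have hT0 : 0 ≤ T := Nat.cast_nonneg _
  have hmk : 0 ≤ (m : ℝ) - k := sub_nonneg.2 hkm'
  have hquad : (n.choose t : ℝ) * ((P.card : ℝ) ^ 2 * ((t : ℝ) / n) ^ 4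
      + P.card * (2 * (d * r)) * ((t : ℝ) / n) ^ 3)
      ≤ n.choose t * ((r.choose 2 * m : ℝ) ^ 2 * ((t : ℝ) / n) ^ 4
        + (r.choose 2 * m : ℝ) * (2 * (d * r)) * ((t : ℝ) / n) ^ 3) := by gcongr
  have hquad0 : 0 ≤ (n.choose t : ℝ) * ((r.choose 2 * m : ℝ) ^ 2 * ((t : ℝ) / n) ^ 4
        + (r.choose 2 * m : ℝ) * (2 * (d * r)) * ((t : ℝ) / n) ^ 3) := by positivity
  have hlin : ((r.choose 2 : ℝ) * ((m : ℝ) - k) + L) * T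
      ≤ ((r.choose 2 : ℝ) * ((m : ℝ) - k) + L) * (n.choose t * ((t : ℝ) / n) ^ 2) := by gcongr
  have h1 : (P.card : ℝ) * T ≤ r.choose 2 * m * T := by gcongr
  have h3 : (r.choose 2 : ℝ) * m * T - P.card * T ≤ ((r.choose 2 : ℝ) * ((m : ℝ) - k) + L) * T := by
    rw [← sub_mul]
    gcongr
    linarith
  rw [abs_le]
  constructor <;> linarith

/-- The real inequality that collects the error terms. -/
theorem error_terms_le {n r m t q ℓ x d L B A : ℝ} (hn : 0 < n) (hr : 1 ≤ r)
    (hnm : n ≤ r ^ 2 * m) (hm : r ^ 4 * m ≤ n ^ 2) (ht : t ≤ 3 * r) (ht0 : 0 ≤ t)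
    (hq0 : 0 ≤ q) (hq : q ≤ r ^ 2) (hℓ : 1 ≤ ℓ) (hx0 : 0 ≤ x) (hx : x ≤ B)
    (hd0 : 0 ≤ d) (hd : d ≤ ℓ + 81 * r ^ 2 * m / n + 4)
    (hL : L ≤ 9 * (4 * ℓ + 4 + 3 * (81 * r ^ 8 * m ^ 3 / (2 * n ^ 4))
      + 81 * r ^ 4 * m ^ 2 / (2 * n ^ 2))) (hA : 0 ≤ A) :
    A * ((q * x + L) * (t / n) ^ 2 + (q * m) ^ 2 * (t / n) ^ 4
        + (q * m) * (2 * (d * r)) * (t / n) ^ 3)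
      ≤ (9 * B + 30000) * ((r ^ 6 * m * n * ℓ + r ^ 8 * m ^ 2) / n ^ 4) * A := by
  have hr0 : 0 < r := by linarith
  have hm0 : 0 < m := by
    by_contra! h
    nlinarith [mul_nonpos_of_nonneg_of_nonpos (sq_nonneg r) h]
  have hB : 0 ≤ B := hx0.trans hx
  set a := r ^ 6 * m / n ^ 3 with ha
  set b := r ^ 8 * m ^ 2 / n ^ 4 with hb
  have ha0 : 0 < a := by positivity
  have hb0 : 0 < b := by positivity
  have hE : (r ^ 6 * m * n * ℓ + r ^ 8 * m ^ 2) / n ^ 4 = a * ℓ + b := by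
    rw [ha, hb]; field_simp
  have haℓ : a ≤ a * ℓ := le_mul_of_one_le_right ha0.le hℓ
  have hra : r ^ 4 / n ^ 2 ≤ a := by
    rw [ha, div_le_div_iff₀ (by positivity) (by positivity)]
    calc r ^ 4 * n ^ 3 = r ^ 4 * n ^ 2 * n := by ring
      _ ≤ r ^ 4 * n ^ 2 * (r ^ 2 * m) := by gcongr
      _ = _ := by ring
  have hra' : r ^ 2 / n ^ 2 ≤ a := by
    refine le_trans ?_ hra
    gcongr
    norm_num
  have ht3 : t / n ≤ 3 * r / n := by gcongr
  have htn0 : 0 ≤ t / n := by positivity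
  have e1 : q * x * (t / n) ^ 2 ≤ 9 * B * (a * ℓ) := by
    calc q * x * (t / n) ^ 2 ≤ r ^ 2 * B * (3 * r / n) ^ 2 := by gcongr
      _ = 9 * B * (r ^ 4 / n ^ 2) := by ring
      _ ≤ 9 * B * (a * ℓ) := by gcongr; linarith
  have hc : (81 * r ^ 8 * m ^ 3 / (2 * n ^ 4)) * (r ^ 2 / n ^ 2) ≤ 81 / 2 * b := by
    calc (81 * r ^ 8 * m ^ 3 / (2 * n ^ 4)) * (r ^ 2 / n ^ 2)
        = 81 / 2 * b * (r ^ 2 * m / n ^ 2) := by rw [hb]; field_simp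
      _ ≤ 81 / 2 * b * 1 := by
        gcongr
        rw [div_le_one (by positivity)]
        refine le_trans ?_ hm
        gcongr
        norm_num
      _ = _ := mul_one _
  have hc' : (81 * r ^ 4 * m ^ 2 / (2 * n ^ 2)) * (r ^ 2 / n ^ 2) ≤ 81 / 2 * b := by
    calc (81 * r ^ 4 * m ^ 2 / (2 * n ^ 2)) * (r ^ 2 / n ^ 2)
        = 81 / 2 * (r ^ 6 * m ^ 2 / n ^ 4) := by field_simp
      _ ≤ 81 / 2 * b := by
        rw [hb]
        gcongr
        norm_num
  have e2 : L * (t / n) ^ 2 ≤ 81 * (8 * (a * ℓ) + 162 * b) := by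
    calc L * (t / n) ^ 2 ≤ (9 * (4 * ℓ + 4 + 3 * (81 * r ^ 8 * m ^ 3 / (2 * n ^ 4))
          + 81 * r ^ 4 * m ^ 2 / (2 * n ^ 2))) * (3 * r / n) ^ 2 := by gcongr
      _ = 81 * ((4 * ℓ + 4) * (r ^ 2 / n ^ 2)
          + 3 * ((81 * r ^ 8 * m ^ 3 / (2 * n ^ 4)) * (r ^ 2 / n ^ 2))
          + (81 * r ^ 4 * m ^ 2 / (2 * n ^ 2)) * (r ^ 2 / n ^ 2)) := by ring
      _ ≤ 81 * (8 * (a * ℓ) + 162 * b) := by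
        have : (4 * ℓ + 4) * (r ^ 2 / n ^ 2) ≤ (8 * ℓ) * a := by gcongr; linarith
        linarith
  have e3 : (q * m) ^ 2 * (t / n) ^ 4 ≤ 81 * b := by
    calc (q * m) ^ 2 * (t / n) ^ 4 ≤ (r ^ 2 * m) ^ 2 * (3 * r / n) ^ 4 := by gcongr
      _ = 81 * b := by rw [hb]; ring
  have e4 : (q * m) * (2 * (d * r)) * (t / n) ^ 3 ≤ 54 * (5 * (a * ℓ) + 81 * b) := by
    calc (q * m) * (2 * (d * r)) * (t / n) ^ 3
        ≤ (r ^ 2 * m) * (2 * ((ℓ + 81 * r ^ 2 * m / n + 4) * r)) * (3 * r / n) ^ 3 := by gcongr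
      _ = 54 * (a * ℓ + 4 * a + 81 * b) := by rw [ha, hb]; field_simp; ring
      _ ≤ _ := by linarith
  rw [hE, mul_comm A]
  refine mul_le_mul_of_nonneg_right ?_ hA
  have : 0 ≤ B * b := by positivity
  linarith

/-- Consequences of the density assumptions `n / r² ≤ m` and `m = o(n^{3/2} / r³)`. -/
theorem density_bounds {n r m : ℝ} (hn : 0 < n) (hr : 1 ≤ r) (hlb : n / r ^ 2 ≤ m)
    (hub : m ≤ 1 / 10 * (n ^ ((3 : ℝ) / 2) / r ^ 3)) :
    100 * r ^ 2 ≤ n ∧ 100 * (r ^ 4 * m) ≤ n ^ 2 := by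
  obtain ⟨s, hs, rfl⟩ : ∃ s : ℝ, 0 < s ∧ s ^ 2 = n :=
    ⟨√n, Real.sqrt_pos.2 hn, Real.sq_sqrt hn.le⟩
  have hr0 : 0 < r := by linarith
  have hpow : (s ^ 2) ^ ((3 : ℝ) / 2) = s ^ 3 := by
    rw [← Real.rpow_natCast s 2, ← Real.rpow_mul hs.le, ← Real.rpow_natCast s 3]
    norm_num
  rw [hpow, ← mul_div_assoc, le_div_iff₀ (by positivity)] at hub
  rw [div_le_iff₀ (by positivity)] at hlb
  have hrs : 10 * r ≤ s := by
    have : s ^ 2 * (10 * r) ≤ s ^ 2 * s := by nlinarith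
    exact le_of_mul_le_mul_left this (by positivity)
  have hm0 : 0 ≤ m := by
    by_contra! h
    nlinarith [mul_pos hr0 hr0, mul_pos hs hs]
  refine ⟨by nlinarith, ?_⟩
  calc 100 * (r ^ 4 * m) = 10 * r * (10 * (m * r ^ 3)) := by ring
    _ ≤ s * s ^ 3 := by gcongr; linarith
    _ = (s ^ 2) ^ 2 := by ring

theorem half_choose_le_sub {n r m t : ℕ} (hn : 0 < n) (ht2 : 2 ≤ t) (ht : t ≤ n)
    (ht3 : t ≤ 3 * r) (hm : 100 * ((r : ℝ) ^ 4 * m) ≤ (n : ℝ) ^ 2) :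
    (n.choose t : ℝ) ≤ 2 * ((n.choose t : ℝ)
      - (r.choose 2 : ℝ) * m * ((n - 2).choose (t - 2) : ℝ)) := by
  have hq : (r.choose 2 : ℝ) ≤ (r : ℝ) ^ 2 := by exact_mod_cast Nat.choose_le_pow r 2
  have hT : ((n - 2).choose (t - 2) : ℝ) ≤ n.choose t * ((t : ℝ) / n) ^ 2 := by
    rw [div_pow, ← mul_div_assoc, le_div_iff₀ (by positivity)]
    exact_mod_cast choose_sub_mul_pow_le ht2 ht
  have ht3' : (t : ℝ) ≤ 3 * r := by exact_mod_cast ht3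
  have : (r.choose 2 : ℝ) * m * ((n - 2).choose (t - 2) : ℝ) ≤ n.choose t * (9 / 100) := by
    calc (r.choose 2 : ℝ) * m * ((n - 2).choose (t - 2) : ℝ)
        ≤ (r : ℝ) ^ 2 * m * (n.choose t * ((3 * r : ℝ) / n) ^ 2) := by
          gcongr
          exact hT.trans (by gcongr)
      _ = n.choose t * (9 * ((r : ℝ) ^ 4 * m / (n : ℝ) ^ 2)) := by ring
      _ ≤ n.choose t * (9 / 100) := by
          gcongr
          rw [mul_div_assoc', div_le_iff₀ (by positivity)]
          linarith
  have : (0 : ℝ) ≤ n.choose t := Nat.cast_nonneg _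
  linarith

/-- **Lemma 3.5**: for `H ∈ H_r^+(n, m-ξ)` with `ξ = O(1)` and `r ≤ t ≤ 3r-4`, the number
`N_t` of `t`-sets of vertices no two of which lie in a common edge of `H` satisfies
`N_t = [C(n,t) - C(r,2) m C(n-2,t-2)] (1 + O((r⁶ m n log(r⁻²n) + r⁸ m²)/n⁴))`. -/
theorem statement6 (r m ξ : ℕ → ℕ) (hr : ∀ n, 3 ≤ r n)
    (hlb : ∀ᶠ n : ℕ in atTop, (n : ℝ) / (r n : ℝ) ^ 2 ≤ (m n : ℝ))
    (hub : (fun n => (m n : ℝ)) =o[atTop]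
      (fun n => (n : ℝ) ^ ((3 : ℝ) / 2) / (r n : ℝ) ^ 3))
    (hξ : ∃ B : ℕ, ∀ n, ξ n ≤ B) :
    ∃ C > (0 : ℝ), ∃ n₀ : ℕ, ∀ n ≥ n₀, ∀ t : ℕ, r n ≤ t → t ≤ 3 * r n - 4 →
      ∀ H ∈ Hplus n (r n) (m n - ξ n),
        |((Finset.univ.powerset.filter fun S : Finset (Fin n) =>
              S.card = t ∧ ∀ e ∈ H, (S ∩ e).card ≤ 1).card : ℝ)
            - ((n.choose t : ℝ)
                - ((r n).choose 2 : ℝ) * (m n : ℝ) * ((n - 2).choose (t - 2) : ℝ))|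
          ≤ C * (((r n : ℝ) ^ 6 * (m n : ℝ) * (n : ℝ)
                  * Real.log ((n : ℝ) / (r n : ℝ) ^ 2)
                + (r n : ℝ) ^ 8 * (m n : ℝ) ^ 2) / (n : ℝ) ^ 4)
            * |(n.choose t : ℝ)
                - ((r n).choose 2 : ℝ) * (m n : ℝ) * ((n - 2).choose (t - 2) : ℝ)| := by
  obtain ⟨B, hB⟩ := hξ
  obtain ⟨n₀, hn₀⟩ := eventually_atTop.1
    ((hlb.and (hub.def (show (0 : ℝ) < 1 / 10 by norm_num))).and (eventually_gt_atTop 0))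
  refine ⟨2 * (9 * B + 30000), by positivity, n₀, fun n hn t hrt ht H hH => ?_⟩
  obtain ⟨⟨hlb, hub⟩, hn0⟩ := hn₀ n hn
  obtain ⟨hHg, h2, hcl, -, -, -, hM1, hM2, hM3, hM4, hdeg⟩ := hH
  obtain ⟨hHr, hHm⟩ := (mem_filter.1 hHg).2
  have hr3 := hr n
  generalize r n = r, m n = m at *
  have hξB := hB n
  generalize ξ n = ξ at *
  have hn0' : (0 : ℝ) < n := by exact_mod_cast hn0
  have hr1 : (1 : ℝ) ≤ r := by exact_mod_cast (by omega : 1 ≤ r)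
  rw [Real.norm_of_nonneg (by positivity), Real.norm_of_nonneg (by positivity)] at hub
  obtain ⟨hrn, hm⟩ := density_bounds hn0' hr1 hlb hub
  have ht3 : t ≤ 3 * r := by omega
  have htn : t ≤ n := by
    have : 100 * r ^ 2 ≤ n := by exact_mod_cast hrn
    nlinarith
  have hhalf := half_choose_le_sub hn0 (by omega) htn ht3 hm
  set ℓ := Real.log ((n : ℝ) / (r : ℝ) ^ 2) with hℓ
  have hℓ1 : 1 ≤ ℓ := by
    rw [hℓ, Real.le_log_iff_exp_le (by positivity), le_div_iff₀ (by positivity)]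
    have := Real.exp_one_lt_d9
    nlinarith [sq_nonneg (r : ℝ)]
  have hmξ : ((m - ξ : ℕ) : ℝ) ≤ m := by exact_mod_cast Nat.sub_le _ _
  have b0 : (M0 n r (m - ξ) : ℝ) ≤ ℓ + 81 * (r : ℝ) ^ 2 * m / n + 4 := by
    have : (M0star n r (m - ξ) : ℝ) ≤ ℓ + 81 * (r : ℝ) ^ 2 * m / n + 1 :=
      natCeil_le_of_le (by gcongr) (by positivity)
    rw [M0]
    push_cast
    linarith
  have b1 : (M1 n r (m - ξ) : ℝ) ≤ ℓ + 81 * (r : ℝ) ^ 8 * (m : ℝ) ^ 3 / (2 * (n : ℝ) ^ 4) + 1 :=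
    natCeil_le_of_le (by gcongr) (by positivity)
  have b2 : (M2 n r (m - ξ) : ℝ) ≤ ℓ + 81 * (r : ℝ) ^ 8 * (m : ℝ) ^ 3 / (2 * (n : ℝ) ^ 4) + 1 :=
    natCeil_le_of_le (by gcongr; norm_num) (by positivity)
  have b3 : (M3 n r (m - ξ) : ℝ) ≤ ℓ + 81 * (r : ℝ) ^ 8 * (m : ℝ) ^ 3 / (2 * (n : ℝ) ^ 4) + 1 :=
    natCeil_le_of_le (by gcongr; norm_num) (by positivity)
  have b4 : (M4 n r (m - ξ) : ℝ) ≤ ℓ + 81 * (r : ℝ) ^ 4 * (m : ℝ) ^ 2 / (2 * (n : ℝ) ^ 2) + 1 :=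
    natCeil_le_of_le (by gcongr) (by positivity)
  have hL : (H.offDiag.filter fun x => (x.1 ∩ x.2).card = 2).card
      ≤ 9 * (M1 n r (m - ξ) + M2 n r (m - ξ) + M3 n r (m - ξ) + M4 n r (m - ξ)) :=
    (card_linked_le hcl).trans (by gcongr)
  refine (abs_card_independent_sub_le hHr hHm (Nat.sub_le m ξ) h2 hL hdeg (by omega) hn0
    htn).trans ?_
  have hx : (m : ℝ) - (m - ξ : ℕ) ≤ B := by
    rw [sub_le_iff_le_add]
    exact_mod_cast (by omega : m ≤ B + (m - ξ))
  refine (error_terms_le (B := B) hn0' hr1 ?_ ?_ (by exact_mod_cast ht3) (Nat.cast_nonneg _)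
    (Nat.cast_nonneg _) (by exact_mod_cast Nat.choose_le_pow r 2) hℓ1 (sub_nonneg.2 hmξ) hx
    (Nat.cast_nonneg _) b0 ?_ (Nat.cast_nonneg _)).trans ?_
  · rwa [div_le_iff₀ (by positivity), mul_comm] at hlb
  · have : (0 : ℝ) ≤ (r : ℝ) ^ 4 * m := by positivity
    linarith
  · push_cast
    linarith
  · calc _ ≤ (9 * (B : ℝ) + 30000) * (((r : ℝ) ^ 6 * m * n * ℓ + (r : ℝ) ^ 8 * (m : ℝ) ^ 2)
            / (n : ℝ) ^ 4) * (2 * |(n.choose t : ℝ)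
              - (r.choose 2 : ℝ) * m * ((n - 2).choose (t - 2) : ℝ)|) := by
          gcongr
          exact hhalf.trans (by gcongr; exact le_abs_self _)
      _ = _ := by ring
end

section
/- Let r = r(n) ≥ 3 and m = m(n) with r^{-2} n ≤ m = o(r^{-3} n^{3/2}) as n → ∞. Then |H_r^+(n,m)| / |H_r(n,m)| = 1 − O( r^6 m^2 / n^3 ) and |H_r^{++}(n,m)| / |H_r(n,m)| = 1 − O( r^6 m^2 / n^3 ). -/
open Filter Finset

theorem choose_sub_mul_pow_le_s9 {N m t : ℕ} (htm : t ≤ m) (hmN : m ≤ N) :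
    (N - t).choose (m - t) * N ^ t ≤ N.choose m * m ^ t := by
  induction t with
  | zero => simp
  | succ t ih =>
    have ih := ih (by omega)
    obtain ⟨a, ha⟩ : ∃ a, N - t = a + 1 := ⟨N - t - 1, by omega⟩
    obtain ⟨b, hb⟩ : ∃ b, m - t = b + 1 := ⟨m - t - 1, by omega⟩
    have ha' : N - (t + 1) = a := by omega
    have hb' : m - (t + 1) = b := by omega
    rw [ha, hb] at ih
    rw [ha', hb']
    have h1 := Nat.add_one_mul_choose_eq a b
    have h2 : (b + 1) * N ≤ m * (a + 1) := by
      obtain rfl : N = a + 1 + t := by omega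
      obtain rfl : m = b + 1 + t := by omega
      have : b ≤ a := by omega
      nlinarith
    refine Nat.le_of_mul_le_mul_left (c := a + 1) ?_ (by omega)
    calc (a + 1) * (a.choose b * N ^ (t + 1))
        = ((a + 1) * a.choose b) * N * N ^ t := by ring
      _ = ((a + 1).choose (b + 1) * N ^ t) * ((b + 1) * N) := by rw [h1]; ring
      _ ≤ (N.choose m * m ^ t) * (m * (a + 1)) := Nat.mul_le_mul ih h2
      _ = (a + 1) * (N.choose m * m ^ (t + 1)) := by ring

/-- Among the `m`-subsets of `X`, those containing a fixed `T` have density at most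
`(m / |X|) ^ |T|`. -/
theorem card_filter_superset_le {α : Type*} [DecidableEq α] (X T : Finset α) {m : ℕ}
    (hm : m ≤ X.card) (hT : T ⊆ X) :
    (((X.powersetCard m).filter (T ⊆ ·)).card : ℝ) ≤
      X.card.choose m * ((m : ℝ) / X.card) ^ T.card := by
  rcases Nat.lt_or_ge m T.card with h | h
  · have : (X.powersetCard m).filter (T ⊆ ·) = ∅ := by
      refine Finset.filter_eq_empty_iff.2 fun H hH hTH => ?_
      have := Finset.card_le_card hTH
      rw [(Finset.mem_powersetCard.1 hH).2] at this
      omega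
    rw [this]
    simp only [Finset.card_empty, Nat.cast_zero]
    positivity
  · have hcard : ((X.powersetCard m).filter (T ⊆ ·)).card ≤
        (X.card - T.card).choose (m - T.card) := by
      rw [← Finset.card_sdiff_of_subset hT, ← Finset.card_powersetCard]
      refine Finset.card_le_card_of_injOn (fun H => H \ T) ?_ ?_
      · intro H hH
        simp only [Finset.coe_filter, Finset.mem_powersetCard, Set.mem_ofPred_eq] at hH
        simp only [Finset.mem_coe, Finset.mem_powersetCard]
        exact ⟨Finset.sdiff_subset_sdiff hH.1.1 le_rfl, by
          rw [Finset.card_sdiff_of_subset hH.2, hH.1.2]⟩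
      · intro H hH K hK hHK
        simp only [Finset.coe_filter, Set.mem_ofPred_eq] at hH hK
        rw [← Finset.sdiff_union_of_subset hH.2, ← Finset.sdiff_union_of_subset hK.2]
        simp only at hHK
        rw [hHK]
    rcases Nat.eq_zero_or_pos X.card with h0 | h0
    · have : T = ∅ := by
        rw [Finset.card_eq_zero] at h0
        exact Finset.subset_empty.1 (h0 ▸ hT)
      subst this
      simp
    · have hpos : (0 : ℝ) < (X.card : ℝ) ^ T.card := by positivity
      rw [div_pow, ← mul_div_assoc, le_div_iff₀ hpos]
      have := (Nat.mul_le_mul_right (X.card ^ T.card) hcard).trans (choose_sub_mul_pow_le_s9 h hm)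
      exact_mod_cast this

/-- `H` contains `Q` pairwise disjoint members of `W`. -/
def HasPacking {α : Type*} (W : Finset (Finset α)) (Q : ℕ) (H : Finset α) : Prop :=
  ∃ P ⊆ W, P.card = Q ∧ (P : Set (Finset α)).PairwiseDisjoint id ∧ ∀ S ∈ P, S ⊆ H

open Classical in
theorem card_hasPacking_le {α : Type*} (X : Finset α) {m t Q : ℕ}
    (W : Finset (Finset α)) (hm : m ≤ X.card) (hW : ∀ S ∈ W, S ⊆ X ∧ S.card = t) :
    (((X.powersetCard m).filter (HasPacking W Q)).card : ℝ) ≤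
      W.card.choose Q * (X.card.choose m * ((m : ℝ) / X.card) ^ (t * Q)) := by
  set I := (W.powersetCard Q).filter
    fun P : Finset (Finset α) => (P : Set (Finset α)).PairwiseDisjoint id
  have hsub : (X.powersetCard m).filter (HasPacking W Q) ⊆
      I.biUnion fun P => (X.powersetCard m).filter (P.biUnion id ⊆ ·) := by
    intro H hH
    obtain ⟨hH, P, hPW, hPQ, hPd, hPH⟩ := Finset.mem_filter.1 hH
    refine Finset.mem_biUnion.2 ⟨P, ?_, ?_⟩
    · exact Finset.mem_filter.2 ⟨Finset.mem_powersetCard.2 ⟨hPW, hPQ⟩, hPd⟩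
    · exact Finset.mem_filter.2 ⟨hH, Finset.biUnion_subset.2 hPH⟩
  have hbound : ∀ P ∈ I, (((X.powersetCard m).filter (P.biUnion id ⊆ ·)).card : ℝ) ≤
      X.card.choose m * ((m : ℝ) / X.card) ^ (t * Q) := by
    intro P hP
    obtain ⟨hP, hPd⟩ := Finset.mem_filter.1 hP
    obtain ⟨hPW, hPQ⟩ := Finset.mem_powersetCard.1 hP
    have hcard : (P.biUnion id).card = t * Q := by
      rw [Finset.card_biUnion hPd, Finset.sum_congr rfl fun S hS =>
        show (id S).card = t from (hW S (hPW hS)).2]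
      simp [hPQ, mul_comm]
    rw [← hcard]
    exact card_filter_superset_le X _ hm (Finset.biUnion_subset.2 fun S hS => (hW S (hPW hS)).1)
  calc (((X.powersetCard m).filter (HasPacking W Q)).card : ℝ)
      ≤ ((I.biUnion fun P => (X.powersetCard m).filter (P.biUnion id ⊆ ·)).card : ℝ) := by
        exact_mod_cast Finset.card_le_card hsub
    _ ≤ ∑ P ∈ I, (((X.powersetCard m).filter (P.biUnion id ⊆ ·)).card : ℝ) := by
        exact_mod_cast Finset.card_biUnion_le
    _ ≤ I.card • (X.card.choose m * ((m : ℝ) / X.card) ^ (t * Q)) :=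
        Finset.sum_le_card_nsmul _ _ _ hbound
    _ ≤ W.card.choose Q * (X.card.choose m * ((m : ℝ) / X.card) ^ (t * Q)) := by
        rw [nsmul_eq_mul]
        gcongr
        rw [← Finset.card_powersetCard]
        exact Finset.card_filter_le _ _

/-- `Q` at least `e³ c μ` makes the Poisson-type tail `μ ^ Q / Q!` at most `e^{-2Q} c^{-Q}`. -/
theorem pow_div_factorial_le_of_le {μ c : ℝ} {Q : ℕ} (hμ : 0 ≤ μ) (hc : 0 < c) (hQ : 0 < Q)
    (h : Real.exp 3 * c * μ ≤ Q) :
    μ ^ Q / (Q.factorial : ℝ) ≤ Real.exp (-2 * Q) * c⁻¹ ^ Q := by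
  have hQ' : (0 : ℝ) < Q := by exact_mod_cast hQ
  have h1 : (Q : ℝ) ^ Q / Q.factorial ≤ Real.exp Q := Real.pow_div_factorial_le_exp _ hQ'.le _
  have h2 : μ ≤ Real.exp (-3) * c⁻¹ * Q := by
    rw [Real.exp_neg]
    have := Real.exp_pos 3
    field_simp
    linarith
  calc μ ^ Q / (Q.factorial : ℝ) ≤ (Real.exp (-3) * c⁻¹ * Q) ^ Q / Q.factorial := by gcongr
    _ = Real.exp (-3 * Q) * c⁻¹ ^ Q * ((Q : ℝ) ^ Q / Q.factorial) := by
        rw [mul_pow, mul_pow, ← Real.exp_nat_mul]; ring_nf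
    _ ≤ Real.exp (-3 * Q) * c⁻¹ ^ Q * Real.exp Q := by gcongr
    _ = Real.exp (-2 * Q) * c⁻¹ ^ Q := by
        rw [mul_right_comm, ← Real.exp_add]; ring_nf

open Classical in
/-- Tail bound for the number of disjoint witnesses contained in a random `m`-subset. -/
theorem card_hasPacking_le_exp {α : Type*} (X : Finset α) {m t Q : ℕ} {μ c : ℝ}
    (W : Finset (Finset α)) (hm : m ≤ X.card) (hW : ∀ S ∈ W, S ⊆ X ∧ S.card = t)
    (hWμ : W.card * ((m : ℝ) / X.card) ^ t ≤ μ) (hc : 0 < c) (hQ : 0 < Q)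
    (h : Real.exp 3 * c * μ ≤ Q) :
    (((X.powersetCard m).filter (HasPacking W Q)).card : ℝ) ≤
      Real.exp (-2 * Q) * c⁻¹ ^ Q * X.card.choose m := by
  have hμ : 0 ≤ μ := le_trans (by positivity) hWμ
  refine (card_hasPacking_le X W hm hW).trans ?_
  have h1 : (W.card.choose Q : ℝ) ≤ (W.card : ℝ) ^ Q / Q.factorial := Nat.choose_le_pow_div _ _
  calc W.card.choose Q * (X.card.choose m * ((m : ℝ) / X.card) ^ (t * Q))
      ≤ (W.card : ℝ) ^ Q / Q.factorial * (X.card.choose m * ((m : ℝ) / X.card) ^ (t * Q)) := by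
        gcongr
    _ = (W.card * ((m : ℝ) / X.card) ^ t) ^ Q / Q.factorial * X.card.choose m := by
        rw [mul_pow, pow_mul]; ring
    _ ≤ μ ^ Q / Q.factorial * X.card.choose m := by gcongr
    _ ≤ _ := by gcongr; exact pow_div_factorial_le_of_le hμ hc hQ h

/-- `H` has `k` edges that together miss at least `s` of the `k * r` vertices they could span. -/
def HasDense {n : ℕ} (r k s : ℕ) (H : Finset (Finset (Fin n))) : Prop :=
  ∃ S ⊆ H, S.card = k ∧ (S.sup id).card + s ≤ k * r

theorem Hgraphs_eq (n r m : ℕ) :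
    Hgraphs n r m = ((univ : Finset (Fin n)).powersetCard r).powersetCard m := by
  ext H
  simp only [Hgraphs, Finset.mem_filter, Finset.mem_univ, true_and, Finset.mem_powersetCard,
    Finset.subset_iff, imp_true_iff]

/-- Exponential moment of the intersection of a fixed set with a random `r`-subset. -/
theorem sum_pow_card_inter_le {n r : ℕ} (hr : r ≤ n) (U : Finset (Fin n)) {z : ℝ} (hz : 0 ≤ z) :
    ∑ e ∈ (univ : Finset (Fin n)).powersetCard r, z ^ (e ∩ U).card ≤
      n.choose r * (1 + z * (r / n)) ^ U.card := by
  calc ∑ e ∈ (univ : Finset (Fin n)).powersetCard r, z ^ (e ∩ U).card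
      ≤ ∑ e ∈ (univ : Finset (Fin n)).powersetCard r, (z + 1) ^ (e ∩ U).card := by
        gcongr; linarith
    _ = ∑ e ∈ (univ : Finset (Fin n)).powersetCard r,
          ∑ A ∈ U.powerset, if A ⊆ e then z ^ A.card else 0 := by
        refine Finset.sum_congr rfl fun e _ => ?_
        rw [← Finset.sum_pow_mul_eq_add_pow, ← Finset.sum_filter]
        refine Finset.sum_congr ?_ fun A _ => by simp
        ext A
        simp only [Finset.mem_powerset, Finset.mem_filter, Finset.subset_inter_iff]
        tauto
    _ = ∑ A ∈ U.powerset, z ^ A.card *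
          (((univ : Finset (Fin n)).powersetCard r).filter (A ⊆ ·)).card := by
        rw [Finset.sum_comm]
        refine Finset.sum_congr rfl fun A _ => ?_
        rw [← Finset.sum_filter, Finset.sum_const, nsmul_eq_mul, mul_comm]
    _ ≤ ∑ A ∈ U.powerset, z ^ A.card * (n.choose r * ((r : ℝ) / n) ^ A.card) := by
        gcongr with A _
        simpa using card_filter_superset_le univ A (m := r) (by simpa using hr)
          (Finset.subset_univ A)
    _ = n.choose r * (1 + z * (r / n)) ^ U.card := by
        rw [add_comm 1, ← Finset.sum_pow_mul_eq_add_pow, Finset.mul_sum]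
        refine Finset.sum_congr rfl fun A _ => ?_
        rw [one_pow, mul_one, mul_pow]; ring

theorem card_sup_le_of_card {n r k : ℕ} {S : Finset (Finset (Fin n))}
    (hS : S ∈ ((univ : Finset (Fin n)).powersetCard r).powersetCard k) :
    (S.sup id).card ≤ k * r := by
  obtain ⟨hS, hk⟩ := Finset.mem_powersetCard.1 hS
  rw [Finset.sup_eq_biUnion, ← hk]
  exact Finset.card_biUnion_le_card_mul _ _ _ fun e he => (Finset.mem_powersetCard.1 (hS he)).2.le

/-- Exponential moment of the number of vertices lost by `k` edges. -/
theorem sum_pow_deficiency_le {n r : ℕ} (hn : 0 < n) (h0 : 0 < r) (hr : r ≤ n) (k : ℕ) :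
    ∑ S ∈ ((univ : Finset (Fin n)).powersetCard r).powersetCard k,
        ((n : ℝ) / r ^ 2) ^ (k * r - (S.sup id).card) ≤
      Real.exp (k ^ 2) * (n.choose r : ℝ) ^ k := by
  set E := (univ : Finset (Fin n)).powersetCard r
  set z : ℝ := (n : ℝ) / r ^ 2
  have hz : 0 < z := by positivity
  induction k with
  | zero => simp
  | succ k ih =>
    have hne : ∀ S ∈ E.powersetCard (k + 1), ∃ e, e ∈ S := fun S hS => by
      have := (Finset.mem_powersetCard.1 hS).2
      exact Finset.card_pos.1 (by omega)
    choose! φ hφ using hne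
    have hinj : Set.InjOn (fun S => (S.erase (φ S), φ S))
        (E.powersetCard (k + 1) : Set (Finset (Finset (Fin n)))) := by
      intro S hS T hT h
      simp only [Prod.mk.injEq] at h
      rw [← Finset.insert_erase (hφ S hS), ← Finset.insert_erase (hφ T hT), h.1, h.2]
    have hexp : ∀ S ∈ E.powersetCard k,
        ∑ e ∈ E, z ^ ((k + 1) * r - (e ∪ S.sup id).card) ≤
          z ^ (k * r - (S.sup id).card) * (Real.exp k * n.choose r) := by
      intro S hS
      have hle := card_sup_le_of_card hS
      calc ∑ e ∈ E, z ^ ((k + 1) * r - (e ∪ S.sup id).card)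
          = ∑ e ∈ E, z ^ (k * r - (S.sup id).card) * z ^ (e ∩ S.sup id).card := by
            refine Finset.sum_congr rfl fun e he => ?_
            have h1 := Finset.card_union_add_card_inter e (S.sup id)
            rw [(Finset.mem_powersetCard.1 he).2] at h1
            rw [← pow_add]
            congr 1
            rw [add_mul]
            omega
        _ = z ^ (k * r - (S.sup id).card) * ∑ e ∈ E, z ^ (e ∩ S.sup id).card := by
            rw [Finset.mul_sum]
        _ ≤ z ^ (k * r - (S.sup id).card) * (n.choose r * (1 + z * (r / n)) ^ (S.sup id).card) := by
            gcongr
            exact sum_pow_card_inter_le hr _ hz.le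
        _ ≤ z ^ (k * r - (S.sup id).card) * (n.choose r * Real.exp k) := by
            gcongr
            have hzr : z * (r / n) = 1 / r := by
              simp only [z]; field_simp
            rw [hzr]
            calc (1 + 1 / (r : ℝ)) ^ (S.sup id).card ≤ (Real.exp (1 / r)) ^ (S.sup id).card := by
                  gcongr
                  rw [add_comm]
                  exact Real.add_one_le_exp _
              _ ≤ (Real.exp (1 / r)) ^ (k * r) := by
                  gcongr
                  exact Real.one_le_exp (by positivity)
              _ = Real.exp k := by
                  rw [← Real.exp_nat_mul]
                  congr 1
                  push_cast
                  field_simp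
        _ = _ := by ring
    calc ∑ S ∈ E.powersetCard (k + 1), z ^ ((k + 1) * r - (S.sup id).card)
        = ∑ p ∈ (E.powersetCard (k + 1)).image (fun S => (S.erase (φ S), φ S)),
            z ^ ((k + 1) * r - (p.2 ∪ p.1.sup id).card) := by
          rw [Finset.sum_image hinj]
          refine Finset.sum_congr rfl fun S hS => ?_
          have : S.sup id = φ S ∪ (S.erase (φ S)).sup id := by
            conv_lhs => rw [← Finset.insert_erase (hφ S hS), Finset.sup_insert]
            rfl
          rw [this]
      _ ≤ ∑ p ∈ E.powersetCard k ×ˢ E, z ^ ((k + 1) * r - (p.2 ∪ p.1.sup id).card) := by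
          refine Finset.sum_le_sum_of_subset_of_nonneg ?_ fun _ _ _ => by positivity
          intro p hp
          obtain ⟨S, hS, rfl⟩ := Finset.mem_image.1 hp
          have hS' := Finset.mem_powersetCard.1 hS
          refine Finset.mem_product.2 ⟨Finset.mem_powersetCard.2 ⟨?_, ?_⟩, hS'.1 (hφ S hS)⟩
          · exact (Finset.erase_subset _ _).trans hS'.1
          · rw [Finset.card_erase_of_mem (hφ S hS), hS'.2]; rfl
      _ = ∑ S ∈ E.powersetCard k, ∑ e ∈ E, z ^ ((k + 1) * r - (e ∪ S.sup id).card) := by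
          rw [Finset.sum_product]
      _ ≤ ∑ S ∈ E.powersetCard k, z ^ (k * r - (S.sup id).card) * (Real.exp k * n.choose r) :=
          Finset.sum_le_sum hexp
      _ ≤ Real.exp (k ^ 2) * (n.choose r : ℝ) ^ k * (Real.exp k * n.choose r) := by
          rw [← Finset.sum_mul]
          gcongr
      _ = Real.exp (k ^ 2 + k) * (n.choose r : ℝ) ^ (k + 1) := by
          rw [Real.exp_add]; ring
      _ ≤ Real.exp ((k + 1 : ℕ) ^ 2) * (n.choose r : ℝ) ^ (k + 1) := by
          gcongr
          push_cast
          nlinarith [(Nat.cast_nonneg k : (0 : ℝ) ≤ k)]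

theorem card_dense_le {n r : ℕ} (hn : 0 < n) (h0 : 0 < r) (hr2 : r ^ 2 ≤ n) (k s : ℕ) :
    ((((((univ : Finset (Fin n)).powersetCard r).powersetCard k).filter
        fun S => (S.sup id).card + s ≤ k * r).card : ℕ) : ℝ) ≤
      Real.exp (k ^ 2) * (n.choose r : ℝ) ^ k * ((r : ℝ) ^ 2 / n) ^ s := by
  have hr : r ≤ n := (Nat.le_self_pow two_ne_zero r).trans hr2
  have hz : 1 ≤ (n : ℝ) / r ^ 2 := by
    rw [le_div_iff₀ (by positivity), one_mul]
    exact_mod_cast hr2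
  have hinv : (r : ℝ) ^ 2 / n = ((n : ℝ) / r ^ 2)⁻¹ := by rw [inv_div]
  rw [hinv, inv_pow, ← div_eq_mul_inv, le_div_iff₀ (by positivity)]
  refine le_trans ?_ (sum_pow_deficiency_le hn h0 hr k)
  rw [← nsmul_eq_mul]
  refine le_trans (Finset.card_nsmul_le_sum _ (fun S : Finset (Finset (Fin n)) =>
    ((n : ℝ) / r ^ 2) ^ (k * r - (S.sup id).card)) _ ?_) ?_
  · intro S hS
    have := (Finset.mem_filter.1 hS).2
    exact pow_le_pow_right₀ hz (by omega)
  · exact Finset.sum_le_sum_of_subset_of_nonneg (Finset.filter_subset _ _)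
      fun _ _ _ => by positivity

open Classical in
theorem card_hasDense_le {n r m : ℕ} (hn : 0 < n) (h0 : 0 < r) (hr2 : r ^ 2 ≤ n)
    (hm : m ≤ n.choose r) (k s : ℕ) :
    (((Hgraphs n r m).filter (HasDense r k s)).card : ℝ) ≤
      Real.exp (k ^ 2) * ((m : ℝ) ^ k * ((r : ℝ) ^ 2 / n) ^ s) * (Hgraphs n r m).card := by
  rw [Hgraphs_eq]
  set E := (univ : Finset (Fin n)).powersetCard r
  have hE : E.card = n.choose r := by simp [E]
  have hNpos : (0 : ℝ) < n.choose r := by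
    exact_mod_cast Nat.choose_pos ((Nat.le_self_pow two_ne_zero r).trans hr2)
  set W := (E.powersetCard k).filter fun S => (S.sup id).card + s ≤ k * r
  have hsub : (E.powersetCard m).filter (HasDense r k s) ⊆
      (E.powersetCard m).filter (HasPacking W 1) := by
    intro H hH
    obtain ⟨hH, S, hSH, hSk, hS⟩ := Finset.mem_filter.1 hH
    refine Finset.mem_filter.2 ⟨hH, {S}, ?_, by simp, by simp, by simpa using hSH⟩
    rw [Finset.singleton_subset_iff]
    exact Finset.mem_filter.2 ⟨Finset.mem_powersetCard.2
      ⟨hSH.trans (Finset.mem_powersetCard.1 hH).1, hSk⟩, hS⟩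
  have hW : ∀ S ∈ W, S ⊆ E ∧ S.card = k := fun S hS =>
    Finset.mem_powersetCard.1 (Finset.mem_filter.1 hS).1
  have h1 := card_hasPacking_le E (m := m) (Q := 1) W (hm.trans hE.ge) hW
  have h2 : (W.card : ℝ) ≤ _ := card_dense_le hn h0 hr2 k s
  calc _ ≤ (((E.powersetCard m).filter (HasPacking W 1)).card : ℝ) := by
        exact_mod_cast Finset.card_le_card hsub
    _ ≤ W.card * (E.card.choose m * ((m : ℝ) / E.card) ^ k) := by simpa using h1
    _ ≤ (Real.exp (k ^ 2) * (n.choose r : ℝ) ^ k * ((r : ℝ) ^ 2 / n) ^ s) *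
        ((n.choose r).choose m * ((m : ℝ) / n.choose r) ^ k) := by
        rw [hE]
        gcongr
    _ = _ := by
        rw [Finset.card_powersetCard, hE, div_pow (m : ℝ)]
        field_simp

theorem IsCluster.subset_of_mem {n : ℕ} {H C D : Finset (Finset (Fin n))} (hC : IsCluster H C)
    (hD : IsCluster H D) {e : Finset (Fin n)} (heC : e ∈ C) (heD : e ∈ D) : C ⊆ D := by
  intro f hf
  induction hC.2.2.1 e heC f hf with
  | refl => exact heD
  | tail _ h ih => exact hD.2.2.2 _ (ih h.1) _ (hC.1 h.2.1) h.2.2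

theorem IsCluster.disjoint {n : ℕ} {H C D : Finset (Finset (Fin n))} (hC : IsCluster H C)
    (hD : IsCluster H D) (h : C ≠ D) : Disjoint C D := by
  rw [Finset.disjoint_left]
  intro e heC heD
  exact h ((hC.subset_of_mem hD heC heD).antisymm (hD.subset_of_mem hC heD heC))

/-- A proper nonempty part of a cluster is linked to one of the remaining edges. -/
theorem IsCluster.exists_link {n : ℕ} {H C S : Finset (Finset (Fin n))} (hC : IsCluster H C)
    (hS : S ⊆ C) (hne : S.Nonempty) (hSC : S ≠ C) :
    ∃ a ∈ S, ∃ b ∈ C, b ∉ S ∧ (a ∩ b).card = 2 := by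
  obtain ⟨e, he⟩ := hne
  obtain ⟨f, hf, hfS⟩ := Finset.exists_of_ssubset (hS.ssubset_of_ne hSC)
  by_contra! hno
  refine hfS ?_
  clear hfS
  induction hC.2.2.1 e (hS he) f hf with
  | refl => exact he
  | tail _ h ih =>
    by_contra hc
    exact hno _ (ih h.1) _ h.2.1 hc h.2.2

theorem card_union_add_le_of_card_inter {α : Type*} [DecidableEq α] {a b U : Finset α} {r j : ℕ}
    (haU : a ⊆ U) (hb : b.card = r) (hab : j ≤ (a ∩ b).card) : (b ∪ U).card + j ≤ U.card + r := by
  have h1 := Finset.card_union_add_card_inter b U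
  have h2 : (a ∩ b).card ≤ (b ∩ U).card := Finset.card_le_card fun x hx => by
    rw [Finset.mem_inter] at hx ⊢
    exact ⟨hx.2, haU hx.1⟩
  omega

/-- A cluster contains connected parts of every size, hence parts missing `2 (k - 1)` vertices. -/
theorem IsCluster.exists_subset_card {n r : ℕ} {H C : Finset (Finset (Fin n))}
    (hC : IsCluster H C) (hH : ∀ e ∈ H, e.card = r) (k : ℕ) (hk : k + 1 ≤ C.card) :
    ∃ S ⊆ C, S.card = k + 1 ∧ (S.sup id).card + 2 * k ≤ (k + 1) * r := by
  induction k with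
  | zero =>
    obtain ⟨e, he⟩ := Finset.card_pos.1 (show 0 < C.card by omega)
    exact ⟨{e}, by simpa using he, by simp, by simp [hH e (hC.1 he)]⟩
  | succ k ih =>
    obtain ⟨S, hSC, hSk, hS⟩ := ih (by omega)
    obtain ⟨a, ha, b, hb, hbS, hab⟩ := hC.exists_link hSC (Finset.card_pos.1 (by omega))
      (by rintro rfl; omega)
    refine ⟨insert b S, Finset.insert_subset hb hSC, by rw [Finset.card_insert_of_notMem hbS, hSk],
      ?_⟩
    have := card_union_add_le_of_card_inter (Finset.le_sup (f := id) ha) (hH b (hC.1 hb)) hab.ge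
    rw [Finset.sup_insert, id, Finset.sup_eq_union]
    have hmul : (k + 1 + 1) * r = (k + 1) * r + r := by ring
    omega

theorem IsCluster.card_sup_add_le {n r : ℕ} {H C : Finset (Finset (Fin n))}
    (hC : IsCluster H C) (hH : ∀ e ∈ H, e.card = r) :
    (C.sup id).card + 2 * (C.card - 1) ≤ C.card * r := by
  have h2 := hC.2.1
  obtain ⟨S, hSC, hSk, hS⟩ := hC.exists_subset_card hH (C.card - 1) (by omega)
  have h1 : C.card - 1 + 1 = C.card := by omega
  rw [h1] at hSk hS
  rwa [Finset.eq_of_subset_of_card_le hSC hSk.ge] at hS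

theorem isType4_of_card_eq_two {n : ℕ} {H C : Finset (Finset (Fin n))} (hC : IsCluster H C)
    (h : C.card = 2) : IsType4 C := by
  obtain ⟨e, f, hef, rfl⟩ := Finset.card_eq_two.1 h
  obtain ⟨a, ha, b, hb, hba, hab⟩ := hC.exists_link (S := {e}) (by simp) (by simp) (by
    intro h'
    rw [← h'] at h
    simp at h)
  rw [Finset.mem_singleton] at ha hba
  subst ha
  rw [Finset.mem_insert, Finset.mem_singleton] at hb
  obtain rfl := hb.resolve_left hba
  exact ⟨_, _, rfl, hef, hab⟩

theorem exists_center_of_card_eq_three {n : ℕ} {H C : Finset (Finset (Fin n))}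
    (hC : IsCluster H C) (h : C.card = 3) :
    ∃ e f g, C = {e, f, g} ∧ e ≠ f ∧ e ≠ g ∧ f ≠ g ∧ (e ∩ f).card = 2 ∧ (e ∩ g).card = 2 := by
  obtain ⟨x, hx⟩ := Finset.card_pos.1 (show 0 < C.card by omega)
  obtain ⟨a, ha, b, hb, hba, hab⟩ := hC.exists_link (S := {x}) (by simpa using hx) (by simp) (by
    intro h'
    rw [← h'] at h
    simp at h)
  rw [Finset.mem_singleton] at ha hba
  subst ha
  have hpair : ({a, b} : Finset (Finset (Fin n))).card = 2 :=
    Finset.card_pair (Ne.symm hba)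
  have hsub : ({a, b} : Finset (Finset (Fin n))) ⊆ C := by
    intro y hy
    rw [Finset.mem_insert, Finset.mem_singleton] at hy
    rcases hy with rfl | rfl <;> assumption
  obtain ⟨d, hd, c, hc, hcd, hdc⟩ := hC.exists_link (S := {a, b}) hsub (by simp) (by
    intro h'
    rw [h'] at hpair
    omega)
  have hca : c ≠ a := fun h => hcd (by simp [h])
  have hcb : c ≠ b := fun h => hcd (by simp [h])
  have hC3 : C = {a, b, c} := by
    symm
    refine Finset.eq_of_subset_of_card_le ?_ ?_
    · intro y hy
      simp only [Finset.mem_insert, Finset.mem_singleton] at hy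
      rcases hy with rfl | rfl | rfl <;> assumption
    · rw [h, Finset.card_eq_three.2 ⟨a, b, c, Ne.symm hba, hca.symm, hcb.symm, rfl⟩]
  rw [Finset.mem_insert, Finset.mem_singleton] at hd
  rcases hd with rfl | rfl
  · exact ⟨d, b, c, hC3, Ne.symm hba, hca.symm, hcb.symm, hab, hdc⟩
  · refine ⟨d, a, c, ?_, hba, hcb.symm, hca.symm, by rwa [Finset.inter_comm], hdc⟩
    rw [hC3, Finset.insert_comm]

theorem isType_of_card_eq_three {n r : ℕ} {H C : Finset (Finset (Fin n))}
    (hC : IsCluster H C) (hH : ∀ e ∈ H, e.card = r) (hr : 3 ≤ r) (h : C.card = 3)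
    (hd : ¬ HasDense r 3 5 H) : IsType1 r C ∨ IsType2 r C ∨ IsType3 r C := by
  obtain ⟨e, f, g, hCe, hef, heg, hfg, hf2, hg2⟩ := exists_center_of_card_eq_three hC h
  have he : e.card = r := hH e (hC.1 (by simp [hCe]))
  have hf : f.card = r := hH f (hC.1 (by simp [hCe]))
  have hg : g.card = r := hH g (hC.1 (by simp [hCe]))
  have hsup : C.sup id = e ∪ f ∪ g := by
    rw [hCe]; simp [Finset.sup_insert, Finset.union_assoc]
  have h1 : ¬ (C.sup id).card + 5 ≤ 3 * r := fun h' => hd ⟨C, hC.1, h, h'⟩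
  rw [hsup] at h1
  have h2 := Finset.card_union_add_card_inter e f
  have h3 := Finset.card_union_add_card_inter (e ∪ f) g
  have h4 : e ∩ g ⊆ (e ∪ f) ∩ g := Finset.inter_subset_inter_right Finset.subset_union_left
  have h5 : (e ∪ f) ∩ g = e ∩ g := by
    symm
    refine Finset.eq_of_subset_of_card_le h4 ?_
    omega
  have h6 : f ∩ g ⊆ e := by
    intro x hx
    have : x ∈ (e ∪ f) ∩ g := by
      simp only [Finset.mem_inter, Finset.mem_union] at hx ⊢
      exact ⟨Or.inr hx.1, hx.2⟩
    rw [h5] at this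
    exact (Finset.mem_inter.1 this).1
  have h7 : (C.sup id).card = 3 * r - 4 := by
    rw [hsup]
    rw [h5] at h3
    omega
  have h8 : ((e ∩ f) ∩ (e ∩ g)).card ≤ 2 := hf2 ▸ Finset.card_le_card Finset.inter_subset_left
  have h9 : ((e ∩ f) ∩ (e ∩ g)).card = 0 ∨ ((e ∩ f) ∩ (e ∩ g)).card = 1 ∨
      ((e ∩ f) ∩ (e ∩ g)).card = 2 := by omega
  rcases h9 with h9 | h9 | h9
  · refine Or.inl ⟨e, f, g, hCe, hef, heg, hfg, h7, hf2, hg2, ?_, h6⟩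
    rwa [Finset.card_eq_zero, ← Finset.disjoint_iff_inter_eq_empty] at h9
  · exact Or.inr (Or.inl ⟨e, f, g, hCe, hef, heg, hfg, h7, hf2, hg2, h9, h6⟩)
  · have hA : (e ∩ f) ∩ (e ∩ g) = e ∩ f :=
      Finset.eq_of_subset_of_card_le Finset.inter_subset_left (by omega)
    have hB : (e ∩ f) ∩ (e ∩ g) = e ∩ g :=
      Finset.eq_of_subset_of_card_le Finset.inter_subset_right (by omega)
    have hAB : e ∩ g = e ∩ f := hB.symm.trans hA
    refine Or.inr (Or.inr ⟨e, f, g, hCe, hef, heg, hfg, h7, e ∩ f, hf2, rfl, hAB, ?_⟩)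
    ext x
    constructor
    · intro hx
      rw [Finset.mem_inter] at hx
      exact Finset.mem_inter.2 ⟨h6 (Finset.mem_inter.2 hx), hx.1⟩
    · intro hx
      have hx' := hAB ▸ hx
      rw [Finset.mem_inter] at hx hx'
      exact Finset.mem_inter.2 ⟨hx.2, hx'.2⟩

theorem IsCluster.card_le_three {n r : ℕ} {H C : Finset (Finset (Fin n))}
    (hC : IsCluster H C) (hH : ∀ e ∈ H, e.card = r) (hd : ¬ HasDense r 4 6 H) : C.card ≤ 3 := by
  by_contra! h
  obtain ⟨S, hSC, hSk, hS⟩ := hC.exists_subset_card hH 3 (by omega)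
  exact hd ⟨S, hSC.trans hC.1, hSk, hS⟩

theorem card_eq_three_of_isType {n r : ℕ} {C : Finset (Finset (Fin n))}
    (h : IsType1 r C ∨ IsType2 r C ∨ IsType3 r C) : C.card = 3 := by
  rcases h with ⟨e, f, g, h, h1, h2, h3, -⟩ | ⟨e, f, g, h, h1, h2, h3, -⟩ |
    ⟨e, f, g, h, h1, h2, h3, -⟩ <;>
  exact Finset.card_eq_three.2 ⟨e, f, g, h1, h2, h3, h⟩

theorem card_eq_two_of_isType4 {n : ℕ} {C : Finset (Finset (Fin n))} (h : IsType4 C) :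
    C.card = 2 := by
  obtain ⟨e, f, h, h1, -⟩ := h
  exact Finset.card_eq_two.2 ⟨e, f, h1, h⟩

theorem card_sup_inter_sup_le_one {n r : ℕ} {H C D : Finset (Finset (Fin n))}
    (hC : IsCluster H C) (hD : IsCluster H D) (hCD : C ≠ D) (hH : ∀ e ∈ H, e.card = r)
    (h46 : ¬ HasDense r 4 6 H) (h58 : ¬ HasDense r 5 8 H) (h610 : ¬ HasDense r 6 10 H) :
    ((C.sup id) ∩ (D.sup id)).card ≤ 1 := by
  by_contra! h
  have hC3 := hC.card_le_three hH h46
  have hD3 := hD.card_le_three hH h46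
  have hC2 := hC.2.1
  have hD2 := hD.2.1
  have h1 := Finset.card_union_add_card_inter (C.sup id) (D.sup id)
  rw [← Finset.sup_eq_union, ← Finset.sup_union] at h1
  have h2 := hC.card_sup_add_le hH
  have h3 := hD.card_sup_add_le hH
  have h4 := Finset.card_union_of_disjoint (hC.disjoint hD hCD)
  have h5 := Finset.union_subset hC.1 hD.1
  rcases (show C.card = 2 ∨ C.card = 3 by omega) with hc | hc <;>
    rcases (show D.card = 2 ∨ D.card = 3 by omega) with hd | hd <;>
    rw [hc] at h2 h4 <;> rw [hd] at h3 h4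
  · exact h46 ⟨C ∪ D, h5, h4, by omega⟩
  · exact h58 ⟨C ∪ D, h5, h4, by omega⟩
  · exact h58 ⟨C ∪ D, h5, h4, by omega⟩
  · exact h610 ⟨C ∪ D, h5, h4, by omega⟩

theorem lt_card_sup_union_of_not_hasDense {n r k s : ℕ} {H C D E : Finset (Finset (Fin n))}
    (hC : IsCluster H C) (hD : IsCluster H D) (hE : IsCluster H E)
    (hCD : C ≠ D) (hCE : C ≠ E) (hDE : D ≠ E) (hk : C.card + D.card + E.card = k)
    (h : ¬ HasDense r k s H) :
    k * r < ((C.sup id) ∪ (D.sup id) ∪ (E.sup id)).card + s := by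
  by_contra! h'
  refine h ⟨C ∪ D ∪ E, Finset.union_subset (Finset.union_subset hC.1 hD.1) hE.1, ?_, ?_⟩
  · rw [Finset.card_union_of_disjoint, Finset.card_union_of_disjoint (hC.disjoint hD hCD), hk]
    exact Finset.disjoint_union_left.2 ⟨hC.disjoint hE hCE, hD.disjoint hE hDE⟩
  · rwa [Finset.sup_union, Finset.sup_union]

theorem hasPacking_of_le_clusterCount {n Q : ℕ} {H : Finset (Finset (Fin n))}
    {P : Finset (Finset (Fin n)) → Prop} {W : Finset (Finset (Finset (Fin n)))}
    (hW : ∀ C, IsCluster H C → P C → C ∈ W) (hQ : Q ≤ clusterCount H P) : HasPacking W Q H := by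
  classical
  have h1 : clusterCount H P = (univ.filter fun C => IsCluster H C ∧ P C).card := by
    rw [clusterCount, ← Set.ncard_coe_finset]
    congr 1
    ext C
    simp
  rw [h1] at hQ
  obtain ⟨F, hF, hFQ⟩ := Finset.exists_subset_card_eq hQ
  have hF' : ∀ C ∈ F, IsCluster H C ∧ P C := fun C hC => (Finset.mem_filter.1 (hF hC)).2
  exact ⟨F, fun C hC => hW C (hF' C hC).1 (hF' C hC).2, hFQ,
    fun C hC D hD hCD => (hF' C hC).1.disjoint (hF' D hD).1 hCD, fun C hC => (hF' C hC).1.1⟩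

theorem hasPacking_of_le_hdegree {n r Q : ℕ} {H : Finset (Finset (Fin n))} {v : Fin n}
    (hH : ∀ e ∈ H, e.card = r) (hQ : Q ≤ hdegree H v) :
    HasPacking ((((univ : Finset (Fin n)).powersetCard r).filter ({v} ⊆ ·)).image
      fun e => {e}) Q H := by
  obtain ⟨F, hF, hFQ⟩ := Finset.exists_subset_card_eq hQ
  refine ⟨F.image fun e => {e}, ?_, ?_, ?_, ?_⟩
  · refine Finset.image_subset_image fun e he => ?_
    have := Finset.mem_filter.1 (hF he)
    simpa using ⟨hH e this.1, this.2⟩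
  · rw [Finset.card_image_of_injective _ Finset.singleton_injective, hFQ]
  · intro S hS T hT hST
    simp only [Finset.coe_image, Set.mem_image, Finset.mem_coe] at hS hT
    obtain ⟨e, -, rfl⟩ := hS
    obtain ⟨f, -, rfl⟩ := hT
    simp only [Function.onFun, id, Finset.disjoint_singleton]
    rintro rfl
    exact hST rfl
  · intro S hS
    obtain ⟨e, he, rfl⟩ := Finset.mem_image.1 hS
    simpa using (Finset.mem_filter.1 (hF he)).1

/-- Triples `{e, f, g}` of `r`-sets where `f` and `g` contain prescribed pairs determined by `e`,
with at most `R` choices for these pairs. -/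
theorem card_triples_le {n r R : ℕ} (hr : r ≤ n) (W : Finset (Finset (Finset (Fin n))))
    (P : Finset (Fin n) → Finset (Finset (Fin n) × Finset (Fin n)))
    (hP : ∀ e, e.card = r → (P e).card ≤ R)
    (hW : ∀ S ∈ W, ∃ e f g, S = {e, f, g} ∧ e.card = r ∧ f.card = r ∧ g.card = r ∧
      (e ∩ f).card = 2 ∧ (e ∩ g).card = 2 ∧ (e ∩ f, e ∩ g) ∈ P e) :
    (W.card : ℝ) ≤ (n.choose r : ℝ) ^ 3 * (R * ((r : ℝ) / n) ^ 4) := by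
  set E := (univ : Finset (Fin n)).powersetCard r
  set F : Finset (Fin n) → Finset (Finset (Fin n)) := fun A => E.filter (A ⊆ ·)
  have hF : ∀ A : Finset (Fin n), A.card = 2 →
      ((F A).card : ℝ) ≤ n.choose r * ((r : ℝ) / n) ^ 2 := by
    intro A hA
    simpa [hA] using card_filter_superset_le univ A (m := r) (by simpa using hr)
      (Finset.subset_univ A)
  set P' := fun e => (P e).filter fun p => p.1.card = 2 ∧ p.2.card = 2
  have hsub : W ⊆ E.biUnion fun e => (P' e).biUnion fun p =>
      (F p.1 ×ˢ F p.2).image fun q => {e, q.1, q.2} := by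
    intro S hS
    obtain ⟨e, f, g, rfl, he, hf, hg, hef, heg, hp⟩ := hW S hS
    simp only [Finset.mem_biUnion, Finset.mem_image, Finset.mem_product]
    refine ⟨e, by simp [E, he], (e ∩ f, e ∩ g), Finset.mem_filter.2 ⟨hp, hef, heg⟩, (f, g),
      ⟨?_, ?_⟩, rfl⟩
    · simp [F, E, hf, Finset.inter_subset_right]
    · simp [F, E, hg, Finset.inter_subset_right]
  have hinner : ∀ e ∈ E, (((P' e).biUnion fun p =>
      (F p.1 ×ˢ F p.2).image fun q => ({e, q.1, q.2} : Finset (Finset (Fin n)))).card : ℝ) ≤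
      R * (n.choose r * ((r : ℝ) / n) ^ 2) ^ 2 := by
    intro e he
    have hcard : ∀ p ∈ P' e, (((F p.1 ×ˢ F p.2).image
        fun q => ({e, q.1, q.2} : Finset (Finset (Fin n)))).card : ℝ) ≤
        (n.choose r * ((r : ℝ) / n) ^ 2) ^ 2 := by
      intro p hp
      obtain ⟨-, h1, h2⟩ := Finset.mem_filter.1 hp
      calc _ ≤ ((F p.1 ×ˢ F p.2).card : ℝ) := by exact_mod_cast Finset.card_image_le
        _ = (F p.1).card * (F p.2).card := by rw [Finset.card_product]; push_cast; rfl
        _ ≤ _ := by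
          rw [sq]
          gcongr
          · exact hF _ h1
          · exact hF _ h2
    calc _ ≤ ∑ p ∈ P' e, (((F p.1 ×ˢ F p.2).image
            fun q => ({e, q.1, q.2} : Finset (Finset (Fin n)))).card : ℝ) := by
          exact_mod_cast Finset.card_biUnion_le
      _ ≤ (P' e).card • (n.choose r * ((r : ℝ) / n) ^ 2) ^ 2 :=
          Finset.sum_le_card_nsmul _ _ _ hcard
      _ ≤ _ := by
          rw [nsmul_eq_mul]
          gcongr
          exact (Finset.card_filter_le _ _).trans (hP e (Finset.mem_powersetCard.1 he).2)
  calc (W.card : ℝ) ≤ ∑ e ∈ E, (((P' e).biUnion fun p =>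
      (F p.1 ×ˢ F p.2).image fun q => ({e, q.1, q.2} : Finset (Finset (Fin n)))).card : ℝ) := by
        exact_mod_cast (Finset.card_le_card hsub).trans Finset.card_biUnion_le
    _ ≤ E.card • (R * (n.choose r * ((r : ℝ) / n) ^ 2) ^ 2) :=
        Finset.sum_le_card_nsmul _ _ _ hinner
    _ = _ := by
        rw [nsmul_eq_mul]
        simp only [E, Finset.card_powersetCard, Finset.card_univ, Fintype.card_fin]
        ring

theorem card_linked_pairs_le {n r : ℕ} (hr : r ≤ n) (W : Finset (Finset (Finset (Fin n))))
    (hW : ∀ S ∈ W, ∃ e f, S = {e, f} ∧ e.card = r ∧ f.card = r ∧ (e ∩ f).card = 2) :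
    (W.card : ℝ) ≤ (n.choose r : ℝ) ^ 2 * ((r : ℝ) ^ 2 * ((r : ℝ) / n) ^ 2) := by
  set E := (univ : Finset (Fin n)).powersetCard r
  set F : Finset (Fin n) → Finset (Finset (Fin n)) := fun A => E.filter (A ⊆ ·)
  have hsub : W ⊆ E.biUnion fun e => (e.powersetCard 2).biUnion fun A =>
      (F A).image fun f => {e, f} := by
    intro S hS
    obtain ⟨e, f, rfl, he, hf, hef⟩ := hW S hS
    simp only [Finset.mem_biUnion, Finset.mem_image]
    refine ⟨e, by simp [E, he], e ∩ f, ?_, f, ?_, rfl⟩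
    · exact Finset.mem_powersetCard.2 ⟨Finset.inter_subset_left, hef⟩
    · simp [F, E, hf, Finset.inter_subset_right]
  have hinner : ∀ e ∈ E, (((e.powersetCard 2).biUnion fun A =>
      (F A).image fun f => ({e, f} : Finset (Finset (Fin n)))).card : ℝ) ≤
      (r : ℝ) ^ 2 * (n.choose r * ((r : ℝ) / n) ^ 2) := by
    intro e he
    have hcard : ∀ A ∈ e.powersetCard 2, (((F A).image
        fun f => ({e, f} : Finset (Finset (Fin n)))).card : ℝ) ≤
        n.choose r * ((r : ℝ) / n) ^ 2 := by
      intro A hA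
      have hA2 := (Finset.mem_powersetCard.1 hA).2
      calc _ ≤ ((F A).card : ℝ) := by exact_mod_cast Finset.card_image_le
        _ ≤ _ := by
          simpa [hA2] using card_filter_superset_le univ A (m := r) (by simpa using hr)
            (Finset.subset_univ A)
    calc _ ≤ ∑ A ∈ e.powersetCard 2, (((F A).image
            fun f => ({e, f} : Finset (Finset (Fin n)))).card : ℝ) := by
          exact_mod_cast Finset.card_biUnion_le
      _ ≤ (e.powersetCard 2).card • (n.choose r * ((r : ℝ) / n) ^ 2) :=
          Finset.sum_le_card_nsmul _ _ _ hcard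
      _ ≤ _ := by
          rw [nsmul_eq_mul, Finset.card_powersetCard, (Finset.mem_powersetCard.1 he).2]
          gcongr
          exact_mod_cast Nat.choose_le_pow r 2
  calc (W.card : ℝ) ≤ ∑ e ∈ E, (((e.powersetCard 2).biUnion fun A =>
      (F A).image fun f => ({e, f} : Finset (Finset (Fin n)))).card : ℝ) := by
        exact_mod_cast (Finset.card_le_card hsub).trans Finset.card_biUnion_le
    _ ≤ E.card • ((r : ℝ) ^ 2 * (n.choose r * ((r : ℝ) / n) ^ 2)) :=
        Finset.sum_le_card_nsmul _ _ _ hinner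
    _ = _ := by
        rw [nsmul_eq_mul]
        simp only [E, Finset.card_powersetCard, Finset.card_univ, Fintype.card_fin]
        ring

open Classical in
/-- The possible clusters of `k` edges with property `P`. -/
noncomputable def clusterWitnesses (n r k : ℕ) (P : Finset (Finset (Fin n)) → Prop) :
    Finset (Finset (Finset (Fin n))) :=
  (((univ : Finset (Fin n)).powersetCard r).powersetCard k).filter P

theorem mem_clusterWitnesses {n r k : ℕ} {P : Finset (Finset (Fin n)) → Prop}
    {S : Finset (Finset (Fin n))} :
    S ∈ clusterWitnesses n r k P ↔ (∀ e ∈ S, e.card = r) ∧ S.card = k ∧ P S := by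
  simp only [clusterWitnesses, Finset.mem_filter, Finset.mem_powersetCard, Finset.subset_iff,
    Finset.mem_univ, imp_true_iff, true_and, and_assoc]

theorem card_type1_le {n r : ℕ} (hr : r ≤ n) :
    ((clusterWitnesses n r 3 (IsType1 r)).card : ℝ) ≤
      (n.choose r : ℝ) ^ 3 * ((r : ℝ) ^ 4 * ((r : ℝ) / n) ^ 4) := by
  have h := card_triples_le (R := r ^ 4) hr (clusterWitnesses n r 3 (IsType1 r))
    (fun e => e.powersetCard 2 ×ˢ e.powersetCard 2) ?_ ?_
  · exact_mod_cast h
  · intro e he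
    rw [Finset.card_product, Finset.card_powersetCard, he]
    calc r.choose 2 * r.choose 2 ≤ r ^ 2 * r ^ 2 :=
          Nat.mul_le_mul (Nat.choose_le_pow r 2) (Nat.choose_le_pow r 2)
      _ = r ^ 4 := by ring
  · intro S hS
    obtain ⟨hS, -, e, f, g, rfl, -, -, -, -, hef, heg, -⟩ := mem_clusterWitnesses.1 hS
    refine ⟨e, f, g, rfl, hS _ (by simp), hS _ (by simp), hS _ (by simp), hef, heg, ?_⟩
    exact Finset.mem_product.2 ⟨Finset.mem_powersetCard.2 ⟨Finset.inter_subset_left, hef⟩,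
      Finset.mem_powersetCard.2 ⟨Finset.inter_subset_left, heg⟩⟩

theorem card_type2_le {n r : ℕ} (hr : r ≤ n) :
    ((clusterWitnesses n r 3 (IsType2 r)).card : ℝ) ≤
      (n.choose r : ℝ) ^ 3 * ((r : ℝ) ^ 3 * ((r : ℝ) / n) ^ 4) := by
  have h := card_triples_le (R := r ^ 3) hr (clusterWitnesses n r 3 (IsType2 r))
    (fun e => (e ×ˢ e ×ˢ e).image fun p => ({p.1, p.2.1}, {p.1, p.2.2})) ?_ ?_
  · exact_mod_cast h
  · intro e he
    refine Finset.card_image_le.trans ?_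
    rw [Finset.card_product, Finset.card_product, he]
    exact le_of_eq (by ring)
  · intro S hS
    obtain ⟨hS, -, e, f, g, rfl, -, -, -, -, hef, heg, h1, -⟩ := mem_clusterWitnesses.1 hS
    refine ⟨e, f, g, rfl, hS _ (by simp), hS _ (by simp), hS _ (by simp), hef, heg, ?_⟩
    have key : ∀ A : Finset (Fin n), A.card = 2 → ∀ x ∈ A, ∃ y ∈ A, A = {x, y} := by
      intro A hA x hx
      obtain ⟨y, hy⟩ := Finset.card_eq_one.1 (show (A.erase x).card = 1 by
        rw [Finset.card_erase_of_mem hx, hA])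
      refine ⟨y, Finset.mem_of_mem_erase (hy ▸ Finset.mem_singleton_self y : y ∈ A.erase x), ?_⟩
      rw [← Finset.insert_erase hx, hy]
    obtain ⟨x, hx⟩ := Finset.card_pos.1 (show 0 < (e ∩ f ∩ (e ∩ g)).card by omega)
    have hx' := Finset.mem_inter.1 hx
    obtain ⟨y, hy, hxy⟩ := key _ hef x hx'.1
    obtain ⟨z, hz, hxz⟩ := key _ heg x hx'.2
    refine Finset.mem_image.2 ⟨(x, y, z), ?_, by rw [hxy, hxz]⟩
    simp only [Finset.mem_product]
    exact ⟨(Finset.mem_inter.1 hx'.1).1, (Finset.mem_inter.1 hy).1, (Finset.mem_inter.1 hz).1⟩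

theorem card_type3_le {n r : ℕ} (hr : r ≤ n) :
    ((clusterWitnesses n r 3 (IsType3 r)).card : ℝ) ≤
      (n.choose r : ℝ) ^ 3 * ((r : ℝ) ^ 2 * ((r : ℝ) / n) ^ 4) := by
  have h := card_triples_le (R := r ^ 2) hr (clusterWitnesses n r 3 (IsType3 r))
    (fun e => (e.powersetCard 2).image fun A => (A, A)) ?_ ?_
  · exact_mod_cast h
  · intro e he
    refine Finset.card_image_le.trans ?_
    rw [Finset.card_powersetCard, he]
    exact Nat.choose_le_pow r 2
  · intro S hS
    obtain ⟨hS, -, e, f, g, rfl, -, -, -, -, s, hs, hef, heg, -⟩ := mem_clusterWitnesses.1 hS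
    refine ⟨e, f, g, rfl, hS _ (by simp), hS _ (by simp), hS _ (by simp), hef ▸ hs, heg ▸ hs, ?_⟩
    refine Finset.mem_image.2 ⟨s, Finset.mem_powersetCard.2 ⟨?_, hs⟩, by rw [hef, heg]⟩
    rw [← hef]
    exact Finset.inter_subset_left

theorem card_type4_le {n r : ℕ} (hr : r ≤ n) :
    ((clusterWitnesses n r 2 IsType4).card : ℝ) ≤
      (n.choose r : ℝ) ^ 2 * ((r : ℝ) ^ 2 * ((r : ℝ) / n) ^ 2) := by
  refine card_linked_pairs_le hr _ fun S hS => ?_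
  obtain ⟨hS, -, e, f, rfl, -, hef⟩ := mem_clusterWitnesses.1 hS
  exact ⟨e, f, rfl, hS _ (by simp), hS _ (by simp), hef⟩

/-- The pairs `(k, s)` such that a typical `r`-graph has no `k` edges missing `s` vertices. -/
def sparsePairs : Finset (ℕ × ℕ) :=
  {(2, 3), (3, 5), (4, 6), (5, 8), (6, 10), (9, 14), (6, 9)}

/-- The `r`-sets containing `v`, as singletons. -/
def starWitnesses (n r : ℕ) (v : Fin n) : Finset (Finset (Finset (Fin n))) :=
  (((univ : Finset (Fin n)).powersetCard r).filter ({v} ⊆ ·)).image fun e => {e}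

theorem mem_HplusAux_of_sparse {n r m d : ℕ} (hr : 3 ≤ r) {H : Finset (Finset (Fin n))}
    (hH : H ∈ Hgraphs n r m) (hd : ∀ p ∈ sparsePairs, ¬ HasDense r p.1 p.2 H)
    (h1 : ¬ HasPacking (clusterWitnesses n r 3 (IsType1 r)) (M1 n r m + 1) H)
    (h2 : ¬ HasPacking (clusterWitnesses n r 3 (IsType2 r)) (M2 n r m + 1) H)
    (h3 : ¬ HasPacking (clusterWitnesses n r 3 (IsType3 r)) (M3 n r m + 1) H)
    (h4 : ¬ HasPacking (clusterWitnesses n r 2 IsType4) (M4 n r m + 1) H)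
    (hdeg : ∀ v, ¬ HasPacking (starWitnesses n r v) (d + 1) H) :
    H ∈ HplusAux n r m d := by
  have hr' : ∀ e ∈ H, e.card = r := (Finset.mem_filter.1 hH).2.1
  have h23 := hd (2, 3) (by simp [sparsePairs])
  have h35 := hd (3, 5) (by simp [sparsePairs])
  have h46 := hd (4, 6) (by simp [sparsePairs])
  have h58 := hd (5, 8) (by simp [sparsePairs])
  have h610 := hd (6, 10) (by simp [sparsePairs])
  have h914 := hd (9, 14) (by simp [sparsePairs])
  have h69 := hd (6, 9) (by simp [sparsePairs])
  have hmem : ∀ {C : Finset (Finset (Fin n))} {k : ℕ} {P : Finset (Finset (Fin n)) → Prop},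
      IsCluster H C → P C → C.card = k → C ∈ clusterWitnesses n r k P :=
    fun hC hP hk => mem_clusterWitnesses.2 ⟨fun e he => hr' e (hC.1 he), hk, hP⟩
  refine ⟨hH, ?_, ?_, ?_, ?_, ?_, ?_, ?_, ?_, ?_, ?_⟩
  · intro e he f hf hef
    by_contra! h
    refine h23 ⟨{e, f}, ?_, Finset.card_pair hef, ?_⟩
    · intro x hx
      rw [Finset.mem_insert, Finset.mem_singleton] at hx
      rcases hx with rfl | rfl <;> assumption
    · have h5 := Finset.card_union_add_card_inter e f
      rw [hr' e he, hr' f hf] at h5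
      simp only [Finset.sup_insert, Finset.sup_singleton, id, Finset.sup_eq_union]
      omega
  · intro C hC
    have hC3 := hC.card_le_three hr' h46
    have hC2 := hC.2.1
    rcases (show C.card = 2 ∨ C.card = 3 by omega) with hc | hc
    · exact Or.inr (Or.inr (Or.inr (isType4_of_card_eq_two hC hc)))
    · rcases isType_of_card_eq_three hC hr' hr hc h35 with h | h | h
      · exact Or.inl h
      · exact Or.inr (Or.inl h)
      · exact Or.inr (Or.inr (Or.inl h))
  · intro C D hC hD hCD
    exact card_sup_inter_sup_le_one hC hD hCD hr' h46 h58 h610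
  · intro C D E hC hD hE hCD hCE hDE tC tD tE
    have := lt_card_sup_union_of_not_hasDense (k := 9) (s := 14) hC hD hE hCD hCE hDE
      (by rw [card_eq_three_of_isType tC, card_eq_three_of_isType tD, card_eq_three_of_isType tE])
      h914
    omega
  · intro C D E hC hD hE hCD hCE hDE tC tD tE
    have := lt_card_sup_union_of_not_hasDense (k := 6) (s := 9) hC hD hE hCD hCE hDE
      (by rw [card_eq_two_of_isType4 tC, card_eq_two_of_isType4 tD, card_eq_two_of_isType4 tE])
      h69
    omega
  · by_contra! h
    exact h1 (hasPacking_of_le_clusterCount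
      (fun C hC hP => hmem hC hP (card_eq_three_of_isType (Or.inl hP))) h)
  · by_contra! h
    exact h2 (hasPacking_of_le_clusterCount
      (fun C hC hP => hmem hC hP (card_eq_three_of_isType (Or.inr (Or.inl hP)))) h)
  · by_contra! h
    exact h3 (hasPacking_of_le_clusterCount
      (fun C hC hP => hmem hC hP (card_eq_three_of_isType (Or.inr (Or.inr hP)))) h)
  · by_contra! h
    exact h4 (hasPacking_of_le_clusterCount
      (fun C hC hP => hmem hC hP (card_eq_two_of_isType4 hP)) h)
  · intro v
    by_contra! h
    exact hdeg v (hasPacking_of_le_hdegree hr' h)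

theorem exp_three_le : Real.exp 3 ≤ 27 := by
  have h1 : Real.exp 3 = Real.exp 1 ^ 3 := by rw [← Real.exp_nat_mul]; norm_num
  have h2 := Real.exp_one_lt_d9
  have h3 : Real.exp 1 ≤ 3 := by linarith
  calc Real.exp 3 = Real.exp 1 ^ 3 := h1
    _ ≤ 3 ^ 3 := pow_le_pow_left₀ (Real.exp_pos 1).le h3 3
    _ = 27 := by norm_num

theorem exp_neg_two_mul_le {n r : ℕ} {Q : ℝ} (hn : 0 < n) (h0 : 0 < r)
    (hQ : Real.log ((n : ℝ) / (r : ℝ) ^ 2) ≤ Q) :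
    Real.exp (-2 * Q) ≤ ((r : ℝ) ^ 2 / n) ^ 2 := by
  have hpos : (0 : ℝ) < (n : ℝ) / (r : ℝ) ^ 2 := by positivity
  have h1 : Real.exp (-2 * Q) = (Real.exp (-Q)) ^ 2 := by
    rw [← Real.exp_nat_mul]; ring_nf
  rw [h1]
  gcongr
  calc Real.exp (-Q) ≤ Real.exp (-Real.log ((n : ℝ) / (r : ℝ) ^ 2)) := by gcongr
    _ = (r : ℝ) ^ 2 / n := by rw [Real.exp_neg, Real.exp_log hpos, inv_div]

section
variable {n r m : ℕ}

open Classical in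
theorem card_hasPacking_clusterWitnesses_le (hn : 0 < n) (h0 : 0 < r) (hr2 : r ^ 2 ≤ n)
    (hm : m ≤ n.choose r) {t M : ℕ} {w : ℝ} (P : Finset (Finset (Fin n)) → Prop)
    (hW : ((clusterWitnesses n r t P).card : ℝ) ≤ (n.choose r : ℝ) ^ t * w)
    (hM : Real.log ((n : ℝ) / (r : ℝ) ^ 2) + 81 * (m ^ t * w) / 2 ≤ M) :
    (((Hgraphs n r m).filter (HasPacking (clusterWitnesses n r t P) (M + 1))).card : ℝ) ≤
      (r : ℝ) ^ 2 / n * (Hgraphs n r m).card := by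
  have hNpos : (0 : ℝ) < n.choose r := by
    exact_mod_cast Nat.choose_pos ((Nat.le_self_pow two_ne_zero r).trans hr2)
  have hlog : 0 ≤ Real.log ((n : ℝ) / (r : ℝ) ^ 2) := by
    refine Real.log_nonneg ?_
    rw [le_div_iff₀ (by positivity), one_mul]
    exact_mod_cast hr2
  have hρ : (r : ℝ) ^ 2 / n ≤ 1 := by
    rw [div_le_one (by positivity)]
    exact_mod_cast hr2
  have hw : 0 ≤ w := by
    by_contra! h
    have : (0 : ℝ) ≤ (n.choose r : ℝ) ^ t * w := le_trans (by positivity) hW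
    exact absurd this (not_le.2 (mul_neg_of_pos_of_neg (by positivity) h))
  have hμ : 0 ≤ (m : ℝ) ^ t * w := by positivity
  rw [Hgraphs_eq]
  set E := (univ : Finset (Fin n)).powersetCard r
  have hE : E.card = n.choose r := by simp [E]
  have h := card_hasPacking_le_exp (m := m) (t := t) (Q := M + 1) (μ := m ^ t * w) (c := 1) E
    (clusterWitnesses n r t P) (hm.trans hE.ge)
    (fun S hS => Finset.mem_powersetCard.1 (Finset.mem_filter.1 hS).1) ?_ one_pos
    (Nat.succ_pos _) ?_
  · refine h.trans ?_
    rw [Finset.card_powersetCard m E]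
    gcongr
    rw [inv_one, one_pow, mul_one]
    refine (exp_neg_two_mul_le hn h0 ?_).trans (pow_le_of_le_one (by positivity) hρ two_ne_zero)
    push_cast
    linarith
  · rw [hE, div_pow]
    calc _ ≤ (n.choose r : ℝ) ^ t * w * ((m : ℝ) ^ t / (n.choose r : ℝ) ^ t) := by gcongr
      _ = _ := by field_simp
  · push_cast
    have := mul_le_mul_of_nonneg_right exp_three_le hμ
    rw [mul_one]
    linarith

theorem card_starWitnesses_le (hr : r ≤ n) (v : Fin n) :
    ((starWitnesses n r v).card : ℝ) ≤ n.choose r * ((r : ℝ) / n) := by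
  have h := card_filter_superset_le univ {v} (m := r) (by simpa using hr) (Finset.subset_univ _)
  simp only [Finset.card_univ, Fintype.card_fin, Finset.card_singleton, pow_one] at h
  refine le_trans ?_ h
  exact_mod_cast Finset.card_image_le

open Classical in
theorem card_hasPacking_starWitnesses_le (hn : 0 < n) (hr : 3 ≤ r) (hr2 : r ^ 2 ≤ n)
    (hm0 : 0 < m) (hm : m ≤ n.choose r) (v : Fin n) :
    (((Hgraphs n r m).filter (HasPacking (starWitnesses n r v) (M0star n r m + 1))).card : ℝ) ≤
      (r : ℝ) ^ 2 / n * (1 / n) * (Hgraphs n r m).card := by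
  have hrn : r ≤ n := (Nat.le_self_pow two_ne_zero r).trans hr2
  have hNpos : (0 : ℝ) < n.choose r := by
    exact_mod_cast Nat.choose_pos hrn
  have hlog : 0 ≤ Real.log ((n : ℝ) / (r : ℝ) ^ 2) := by
    refine Real.log_nonneg ?_
    rw [le_div_iff₀ (by positivity), one_mul]
    exact_mod_cast hr2
  have hμ : 0 < (r : ℝ) ^ 2 * m / n := by positivity
  have hM : Real.log ((n : ℝ) / (r : ℝ) ^ 2) + 81 * (r : ℝ) ^ 2 * (m : ℝ) / (n : ℝ) ≤
      M0star n r m := Nat.le_ceil _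
  have hM' : 81 * (r : ℝ) ^ 2 * (m : ℝ) / (n : ℝ) = 81 * ((r : ℝ) ^ 2 * m / n) := by ring
  rw [hM'] at hM
  have hMpos : 1 ≤ M0star n r m := by
    have : (0 : ℝ) < M0star n r m := by linarith
    exact_mod_cast this
  rw [Hgraphs_eq]
  set E := (univ : Finset (Fin n)).powersetCard r
  have hE : E.card = n.choose r := by simp [E]
  have h := card_hasPacking_le_exp (m := m) (t := 1) (Q := M0star n r m + 1)
    (μ := m * ((r : ℝ) / n)) (c := r) E (starWitnesses n r v) (hm.trans hE.ge) ?_ ?_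
    (by positivity) (Nat.succ_pos _) ?_
  · refine h.trans ?_
    rw [Finset.card_powersetCard m E]
    refine mul_le_mul_of_nonneg_right ?_ (Nat.cast_nonneg _)
    calc _ ≤ ((r : ℝ) ^ 2 / n) ^ 2 * (r : ℝ)⁻¹ ^ 2 := by
          refine mul_le_mul (exp_neg_two_mul_le hn (by omega) ?_)
            (pow_le_pow_of_le_one (by positivity) (inv_le_one_of_one_le₀ ?_) (by omega))
            (by positivity) (by positivity)
          · push_cast
            linarith
          · exact_mod_cast (by omega : 1 ≤ r)
      _ = _ := by field_simp
  · intro S hS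
    obtain ⟨e, he, rfl⟩ := Finset.mem_image.1 hS
    exact ⟨Finset.singleton_subset_iff.2 (Finset.mem_filter.1 he).1, Finset.card_singleton _⟩
  · rw [hE, pow_one]
    calc _ ≤ n.choose r * ((r : ℝ) / n) * ((m : ℝ) / n.choose r) := by
          gcongr
          exact card_starWitnesses_le hrn v
      _ = _ := by field_simp
  · push_cast
    have h1 := mul_le_mul_of_nonneg_right exp_three_le hμ.le
    have h2 : Real.exp 3 * r * (m * ((r : ℝ) / n)) = Real.exp 3 * ((r : ℝ) ^ 2 * m / n) := by ring
    rw [h2]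
    linarith

theorem pow_mul_pow_le_of_mem_sparsePairs {x ρ : ℝ} (hx : 0 ≤ x) (hρ : 0 ≤ ρ)
    (hT : x ^ 2 * ρ ^ 3 ≤ 1) (hxρ : x * ρ ^ 2 ≤ 1) {p : ℕ × ℕ} (hp : p ∈ sparsePairs) :
    x ^ p.1 * ρ ^ p.2 ≤ x ^ 2 * ρ ^ 3 := by
  have hT0 : 0 ≤ x ^ 2 * ρ ^ 3 := by positivity
  have hy0 : 0 ≤ x * ρ ^ 2 := by positivity
  have key : ∀ a b : ℕ, (x ^ 2 * ρ ^ 3) ^ (a + 1) * (x * ρ ^ 2) ^ b ≤ x ^ 2 * ρ ^ 3 := by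
    intro a b
    calc (x ^ 2 * ρ ^ 3) ^ (a + 1) * (x * ρ ^ 2) ^ b ≤ (x ^ 2 * ρ ^ 3) ^ (a + 1) * 1 := by
          gcongr
          exact pow_le_one₀ hy0 hxρ
      _ ≤ x ^ 2 * ρ ^ 3 := by
          rw [mul_one]
          exact pow_le_of_le_one hT0 hT (Nat.succ_ne_zero a)
  simp only [sparsePairs, Finset.mem_insert, Finset.mem_singleton] at hp
  rcases hp with rfl | rfl | rfl | rfl | rfl | rfl | rfl
  · exact le_rfl
  · exact le_trans (le_of_eq (by ring)) (key 0 1)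
  · exact le_trans (le_of_eq (by ring)) (key 1 0)
  · exact le_trans (le_of_eq (by ring)) (key 1 1)
  · exact le_trans (le_of_eq (by ring)) (key 1 2)
  · exact le_trans (le_of_eq (by ring)) (key 3 1)
  · exact le_trans (le_of_eq (by ring)) (key 2 0)

theorem le_choose_of_sq_mul_le (hn : 0 < n) (hr : 3 ≤ r) (hrn : r ≤ n)
    (h : (m : ℝ) ^ 2 * (r : ℝ) ^ 6 ≤ (n : ℝ) ^ 3) : m ≤ n.choose r := by
  have hn1 : (1 : ℝ) ≤ n := by exact_mod_cast hn
  have h1 : 1 ≤ (n : ℝ) / r := by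
    rw [le_div_iff₀ (by positivity), one_mul]
    exact_mod_cast hrn
  have h2 : (m : ℝ) ≤ ((n : ℝ) / r) ^ 3 := by
    rw [div_pow, le_div_iff₀ (by positivity)]
    refine le_of_sq_le_sq ?_ (by positivity)
    calc ((m : ℝ) * (r : ℝ) ^ 3) ^ 2 = (m : ℝ) ^ 2 * (r : ℝ) ^ 6 := by ring
      _ ≤ (n : ℝ) ^ 3 := h
      _ ≤ (n : ℝ) ^ 6 := pow_le_pow_right₀ hn1 (by norm_num)
      _ = ((n : ℝ) ^ 3) ^ 2 := by ring
  have h3 : ((n : ℝ) / r) ^ r ≤ n.choose r := by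
    rw [div_pow, div_le_iff₀ (by positivity)]
    have := choose_sub_mul_pow_le_s9 le_rfl hrn
    rw [Nat.sub_self, Nat.choose_zero_right, one_mul] at this
    exact_mod_cast this
  exact_mod_cast h2.trans ((pow_le_pow_right₀ h1 hr).trans h3)

theorem sq_le_of_le_mul_sq (hn : 0 < n) (h1 : (n : ℝ) ≤ m * (r : ℝ) ^ 2)
  (h2 : (m : ℝ) ^ 2 * (r : ℝ) ^ 6 ≤ (n : ℝ) ^ 3) : r ^ 2 ≤ n := by
  have h3 : (n : ℝ) ^ 2 * (r : ℝ) ^ 2 ≤ (n : ℝ) ^ 2 * n := by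
    calc (n : ℝ) ^ 2 * (r : ℝ) ^ 2 ≤ (m * (r : ℝ) ^ 2) ^ 2 * (r : ℝ) ^ 2 := by gcongr
      _ = (m : ℝ) ^ 2 * (r : ℝ) ^ 6 := by ring
      _ ≤ _ := h2
      _ = _ := by ring
  exact_mod_cast le_of_mul_le_mul_left h3 (by positivity)

/-- The number of `r`-graphs violating the properties of `Hplusplus`. -/
theorem card_not_mem_HplusAux_le (hn : 0 < n) (hr : 3 ≤ r) (h1 : (n : ℝ) ≤ m * (r : ℝ) ^ 2)
    (h2 : (m : ℝ) ^ 2 * (r : ℝ) ^ 6 ≤ (n : ℝ) ^ 3) :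
    (((Hgraphs n r m : Set (Finset (Finset (Fin n)))) \ Hplusplus n r m).ncard : ℝ) ≤
      (∑ p ∈ sparsePairs, Real.exp (p.1 ^ 2) + 5) *
        ((r : ℝ) ^ 6 * (m : ℝ) ^ 2 / (n : ℝ) ^ 3) * (Hgraphs n r m).card := by
  classical
  have hn' : (0 : ℝ) < n := by exact_mod_cast hn
  have hr0 : (0 : ℝ) < r := by positivity
  have hm0 : 0 < m := by
    rcases Nat.eq_zero_or_pos m with rfl | h
    · simp only [Nat.cast_zero, zero_mul] at h1; linarith
    · exact h
  have hr2 := sq_le_of_le_mul_sq hn h1 h2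
  have hrn : r ≤ n := (Nat.le_self_pow two_ne_zero r).trans hr2
  have hm := le_choose_of_sq_mul_le hn hr hrn h2
  set ρ : ℝ := (r : ℝ) ^ 2 / n with hρdef
  have hρ : 0 < ρ := by positivity
  have hρ1 : ρ ≤ 1 := by
    rw [hρdef, div_le_one hn']
    exact_mod_cast hr2
  have hTeq : (r : ℝ) ^ 6 * (m : ℝ) ^ 2 / (n : ℝ) ^ 3 = (m : ℝ) ^ 2 * ρ ^ 3 := by
    rw [hρdef]; ring
  rw [hTeq]
  set T : ℝ := (m : ℝ) ^ 2 * ρ ^ 3 with hT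
  have hT1 : T ≤ 1 := by
    rw [← hTeq, div_le_one (by positivity)]
    linarith
  have hmρ : 1 ≤ m * ρ := by
    rw [hρdef, ← mul_div_assoc, le_div_iff₀ hn', one_mul]
    exact h1
  have hρT : ρ ≤ T := by
    calc ρ = 1 ^ 2 * ρ := by ring
      _ ≤ (m * ρ) ^ 2 * ρ := by gcongr
      _ = T := by rw [hT]; ring
  have hy : m * ρ ^ 2 ≤ 1 := by
    refine le_of_sq_le_sq ?_ zero_le_one
    calc (m * ρ ^ 2) ^ 2 = T * ρ := by rw [hT]; ring
      _ ≤ 1 ^ 2 := by rw [one_pow]; exact mul_le_one₀ hT1 hρ.le hρ1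
  set G := Hgraphs n r m
  set D : ℕ × ℕ → Finset (Finset (Finset (Fin n))) := fun p => G.filter (HasDense r p.1 p.2)
  set B1 := G.filter (HasPacking (clusterWitnesses n r 3 (IsType1 r)) (M1 n r m + 1))
  set B2 := G.filter (HasPacking (clusterWitnesses n r 3 (IsType2 r)) (M2 n r m + 1))
  set B3 := G.filter (HasPacking (clusterWitnesses n r 3 (IsType3 r)) (M3 n r m + 1))
  set B4 := G.filter (HasPacking (clusterWitnesses n r 2 IsType4) (M4 n r m + 1))
  set B0 : Fin n → Finset (Finset (Finset (Fin n))) := fun v =>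
    G.filter (HasPacking (starWitnesses n r v) (M0star n r m + 1))
  have hsub : (G : Set (Finset (Finset (Fin n)))) \ Hplusplus n r m ⊆
      (sparsePairs.biUnion D ∪ (B1 ∪ (B2 ∪ (B3 ∪ (B4 ∪ univ.biUnion B0)))) : Finset _) := by
    rintro H ⟨hH, hHp⟩
    by_contra hno
    simp only [Finset.coe_union, Set.mem_union, not_or, Finset.mem_coe, Finset.mem_biUnion,
      not_exists, not_and, B0, B1, B2, B3, B4, D, Finset.mem_filter] at hno
    obtain ⟨k0, k1, k2, k3, k4, k5⟩ := hno
    exact hHp (mem_HplusAux_of_sparse hr hH (fun p hp => k0 p hp hH) (k1 hH) (k2 hH) (k3 hH)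
      (k4 hH) (fun v => k5 v (Finset.mem_univ v) hH))
  have hG : (0 : ℝ) ≤ G.card := by positivity
  have hD : ((sparsePairs.biUnion D).card : ℝ) ≤
      ∑ p ∈ sparsePairs, Real.exp (p.1 ^ 2) * T * G.card := by
    calc ((sparsePairs.biUnion D).card : ℝ) ≤ ∑ p ∈ sparsePairs, ((D p).card : ℝ) := by
          exact_mod_cast Finset.card_biUnion_le
      _ ≤ _ := by
          refine Finset.sum_le_sum fun p hp =>
            (card_hasDense_le hn (by omega) hr2 hm p.1 p.2).trans ?_
          gcongr
          exact pow_mul_pow_le_of_mem_sparsePairs (by positivity) hρ.le hT1 hy hp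
  have hB1 : (B1.card : ℝ) ≤ ρ * G.card :=
    card_hasPacking_clusterWitnesses_le hn (by omega) hr2 hm _ (card_type1_le hrn)
      (le_trans (le_of_eq (by ring)) (Nat.le_ceil _))
  have hB2 : (B2.card : ℝ) ≤ ρ * G.card :=
    card_hasPacking_clusterWitnesses_le hn (by omega) hr2 hm _ (card_type2_le hrn)
      (le_trans (le_of_eq (by ring)) (Nat.le_ceil _))
  have hB3 : (B3.card : ℝ) ≤ ρ * G.card :=
    card_hasPacking_clusterWitnesses_le hn (by omega) hr2 hm _ (card_type3_le hrn)
      (le_trans (le_of_eq (by ring)) (Nat.le_ceil _))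
  have hB4 : (B4.card : ℝ) ≤ ρ * G.card :=
    card_hasPacking_clusterWitnesses_le hn (by omega) hr2 hm _ (card_type4_le hrn)
      (le_trans (le_of_eq (by ring)) (Nat.le_ceil _))
  have hB0 : ((univ.biUnion B0).card : ℝ) ≤ ρ * G.card := by
    calc ((univ.biUnion B0).card : ℝ) ≤ ∑ v, ((B0 v).card : ℝ) := by
          exact_mod_cast Finset.card_biUnion_le
      _ ≤ ∑ _v : Fin n, ρ * (1 / n) * G.card :=
          Finset.sum_le_sum fun v _ => card_hasPacking_starWitnesses_le hn hr hr2 hm0 hm v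
      _ = ρ * G.card := by
          rw [Finset.sum_const, Finset.card_univ, Fintype.card_fin, nsmul_eq_mul]
          field_simp
  have hρG : ρ * G.card ≤ T * G.card := by gcongr
  have hunion : ∀ A B : Finset (Finset (Finset (Fin n))),
      ((A ∪ B).card : ℝ) ≤ A.card + B.card := fun A B => by exact_mod_cast Finset.card_union_le A B
  have hncard := Set.ncard_le_ncard hsub (Finset.finite_toSet _)
  rw [Set.ncard_coe_finset] at hncard
  have hncard' : (((G : Set (Finset (Finset (Fin n)))) \ Hplusplus n r m).ncard : ℝ) ≤ _ :=
    Nat.cast_le.2 hncard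
  rw [← Finset.sum_mul, ← Finset.sum_mul] at hD
  have u1 := hunion (sparsePairs.biUnion D) (B1 ∪ (B2 ∪ (B3 ∪ (B4 ∪ univ.biUnion B0))))
  have u2 := hunion B1 (B2 ∪ (B3 ∪ (B4 ∪ univ.biUnion B0)))
  have u3 := hunion B2 (B3 ∪ (B4 ∪ univ.biUnion B0))
  have u4 := hunion B3 (B4 ∪ univ.biUnion B0)
  have u5 := hunion B4 (univ.biUnion B0)
  linarith

theorem Hplusplus_subset_Hplus : Hplusplus n r m ⊆ Hplus n r m := by
  rintro H ⟨g, ha, hb, hc, hd, he, f1, f2, f3, f4, hg⟩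
  exact ⟨g, ha, hb, hc, hd, he, f1, f2, f3, f4, fun v => (hg v).trans (Nat.le_add_right _ 3)⟩

/-- A subfamily missing at most a fraction `ε` of a finite family has density `1` up to `ε`. -/
theorem abs_ncard_div_sub_one_le {α : Type*} {G : Finset α} {A B : Set α} {ε : ℝ}
    (hG : G.Nonempty) (hBA : B ⊆ A) (hA : A ⊆ G)
    (h : (((G : Set α) \ B).ncard : ℝ) ≤ ε * G.card) :
    |(A.ncard : ℝ) / (G.card : ℝ) - 1| ≤ ε := by
  have hpos : (0 : ℝ) < G.card := by exact_mod_cast hG.card_pos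
  have h1 : ((G : Set α) \ A).ncard + A.ncard = G.card := by
    rw [Set.ncard_sdiff_add_ncard_of_subset hA (Finset.finite_toSet G), Set.ncard_coe_finset]
  have h2 : ((G : Set α) \ A).ncard ≤ ((G : Set α) \ B).ncard :=
    Set.ncard_le_ncard (Set.sdiff_subset_sdiff_right hBA) ((Finset.finite_toSet G).sdiff)
  have h1' : (((G : Set α) \ A).ncard : ℝ) + A.ncard = G.card := by exact_mod_cast h1
  have h2' : (((G : Set α) \ A).ncard : ℝ) ≤ ((G : Set α) \ B).ncard := by exact_mod_cast h2
  have h3 : (A.ncard : ℝ) / (G.card : ℝ) - 1 = -(((G : Set α) \ A).ncard / G.card) := by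
    field_simp
    linarith
  rw [h3, abs_neg, abs_of_nonneg (by positivity), div_le_iff₀ hpos]
  linarith

end

/-- **Theorem 3.2**: for `r⁻²n ≤ m = o(r⁻³n^{3/2})`, almost all `r`-graphs with `m` edges lie
in `H_r^+(n,m)` and in `H_r^{++}(n,m)`, up to relative error `O(r⁶m²/n³)`. -/
theorem statement9 (r m : ℕ → ℕ) (hr : ∀ n, 3 ≤ r n)
    (hlb : ∀ᶠ n : ℕ in atTop, (n : ℝ) / (r n : ℝ) ^ 2 ≤ (m n : ℝ))
    (hub : (fun n => (m n : ℝ)) =o[atTop]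
      (fun n => (n : ℝ) ^ ((3 : ℝ) / 2) / (r n : ℝ) ^ 3)) :
    ∃ C > (0 : ℝ), ∃ n₀ : ℕ, ∀ n ≥ n₀,
      |((Hplus n (r n) (m n)).ncard : ℝ) / ((Hgraphs n (r n) (m n)).card : ℝ) - 1|
          ≤ C * (r n : ℝ) ^ 6 * (m n : ℝ) ^ 2 / (n : ℝ) ^ 3 ∧
      |((Hplusplus n (r n) (m n)).ncard : ℝ) / ((Hgraphs n (r n) (m n)).card : ℝ) - 1|
          ≤ C * (r n : ℝ) ^ 6 * (m n : ℝ) ^ 2 / (n : ℝ) ^ 3 := by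
  have hub' := hub.bound one_pos
  obtain ⟨n₁, hn₁⟩ := eventually_atTop.1 (hlb.and (hub'.and (eventually_gt_atTop 0)))
  refine ⟨∑ p ∈ sparsePairs, Real.exp (p.1 ^ 2) + 5, by positivity, n₁, fun n hn => ?_⟩
  obtain ⟨h1, h2, hn0⟩ := hn₁ n hn
  have hn' : (0 : ℝ) < n := by exact_mod_cast hn0
  have hr3 := hr n
  have hr0 : (0 : ℝ) < r n := by
    have : 0 < r n := by omega
    exact_mod_cast this
  rw [div_le_iff₀ (by positivity)] at h1
  rw [one_mul, Real.norm_of_nonneg (by positivity), Real.norm_of_nonneg (by positivity),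
    le_div_iff₀ (by positivity)] at h2
  have h3 : (m n : ℝ) ^ 2 * (r n : ℝ) ^ 6 ≤ (n : ℝ) ^ 3 := by
    calc (m n : ℝ) ^ 2 * (r n : ℝ) ^ 6 = ((m n : ℝ) * (r n : ℝ) ^ 3) ^ 2 := by ring
      _ ≤ ((n : ℝ) ^ ((3 : ℝ) / 2)) ^ 2 := by gcongr
      _ = (n : ℝ) ^ 3 := by
        rw [← Real.rpow_natCast, ← Real.rpow_mul hn'.le, ← Real.rpow_natCast]
        norm_num
  have hbad := card_not_mem_HplusAux_le hn0 hr3 h1 h3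
  have hG : (Hgraphs n (r n) (m n)).Nonempty := by
    have hrn : r n ≤ n := (Nat.le_self_pow two_ne_zero _).trans (sq_le_of_le_mul_sq hn0 h1 h3)
    rw [Hgraphs_eq, Finset.powersetCard_nonempty, Finset.card_powersetCard, Finset.card_univ,
      Fintype.card_fin]
    exact le_choose_of_sq_mul_le hn0 hr3 hrn h3
  have hsub : ∀ d, HplusAux n (r n) (m n) d ⊆ Hgraphs n (r n) (m n) := fun d H hH => hH.1
  rw [mul_assoc, mul_div_assoc]
  exact ⟨abs_ncard_div_sub_one_le hG Hplusplus_subset_Hplus (hsub _) hbad,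
    abs_ncard_div_sub_one_le hG subset_rfl (hsub _) hbad⟩
end
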